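/- arXiv:math/0403161 — 3 statements merged into one kernel-verified Lean document; each statement's English description precedes it below -/
import Mathlib

section
/- Let G be a subgroup of D₂ₙ, let A_G(α) be the G-orbit of L(α) and M_G(α) = Wₙ \ ⋃A_G(α). If there is no continuous G-equivariant map F : V₂(ℝ³) → M_G(α), then for every pair μ, ν of proper Borel probability measures on S² there exists a 4-fan which is an (a₁/n, a₂/n, a₃/n, a₄/n)-partition for both μ and ν. -/
noncomputable section

open scoped BigOperators

/-- The cyclic shift `σ(x₁,…,xₙ) = (x₂,…,xₙ,x₁)`, i.e. `(σ x) i = x (i+1)`. -/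
def cyclicShift (n : ℕ) (x : Fin n → ℝ) : Fin n → ℝ := fun i => x (finRotate n i)

/-- The reversal `τ(x₁,…,xₙ) = (xₙ,…,x₂,x₁)`. -/
def revShift (n : ℕ) (x : Fin n → ℝ) : Fin n → ℝ := fun i => x i.rev

/-- The hyperplane `Wₙ = {x ∈ ℝⁿ : x₁ + ⋯ + xₙ = 0}`. -/
def Wset (n : ℕ) : Set (Fin n → ℝ) := {x | ∑ i, x i = 0}

/-- The linear subspace `L(α) ⊆ Wₙ` cut out by the vanishing of the four consecutive
block sums of lengths `a₁, a₂, a₃, a₄`. -/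
def Lset (n a₁ a₂ a₃ a₄ : ℕ) : Set (Fin n → ℝ) :=
  {x | x ∈ Wset n ∧
    ∑ i ∈ Finset.univ.filter (fun i : Fin n => (i : ℕ) < a₁), x i = 0 ∧
    ∑ i ∈ Finset.univ.filter (fun i : Fin n => a₁ ≤ (i : ℕ) ∧ (i : ℕ) < a₁ + a₂), x i = 0 ∧
    ∑ i ∈ Finset.univ.filter
      (fun i : Fin n => a₁ + a₂ ≤ (i : ℕ) ∧ (i : ℕ) < a₁ + a₂ + a₃), x i = 0 ∧
    ∑ i ∈ Finset.univ.filter (fun i : Fin n => a₁ + a₂ + a₃ ≤ (i : ℕ)), x i = 0}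

/-- The action of `D₂ₙ` on `ℝⁿ`: `ω` (i.e. `r 1`) acts as the cyclic shift `σ` and
`κ` (i.e. `sr 0`) acts as the reversal `τ`; thus `r k` acts as `σᵏ` and `sr k` as `τ∘σᵏ`. -/
def actW (n : ℕ) : DihedralGroup n → (Fin n → ℝ) → (Fin n → ℝ)
  | DihedralGroup.r k => (cyclicShift n)^[k.val]
  | DihedralGroup.sr k => fun x => revShift n ((cyclicShift n)^[k.val] x)

/-- The union `⋃ A_G(α)` of the `G`-orbit of `L(α)`, for a subgroup `G ≤ D₂ₙ`. -/
def GArrangementUnion (n a₁ a₂ a₃ a₄ : ℕ) (G : Subgroup (DihedralGroup n)) :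
    Set (Fin n → ℝ) :=
  ⋃ g ∈ (G : Set (DihedralGroup n)), actW n g '' Lset n a₁ a₂ a₃ a₄

/-- The complement `M_G(α) = Wₙ \ ⋃ A_G(α)`. -/
def MG (n a₁ a₂ a₃ a₄ : ℕ) (G : Subgroup (DihedralGroup n)) : Set (Fin n → ℝ) :=
  Wset n \ GArrangementUnion n a₁ a₂ a₃ a₄ G

/-- The Stiefel manifold `V₂(ℝ³) = {(x,y) ∈ S² × S² : ⟨x,y⟩ = 0}`. -/
def V2 : Set ((Fin 3 → ℝ) × (Fin 3 → ℝ)) :=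
  {p | (∑ i, p.1 i ^ 2) = 1 ∧ (∑ i, p.2 i ^ 2) = 1 ∧ (∑ i, p.1 i * p.2 i) = 0}

/-- The rotation `R_x(θ)` of `ℝ³` about the axis spanned by the unit vector `x` through
the angle `θ` (Rodrigues' formula). -/
def rotAboutAxis (x : Fin 3 → ℝ) (θ : ℝ) (y : Fin 3 → ℝ) : Fin 3 → ℝ :=
  Real.cos θ • y + Real.sin θ • (crossProduct x y) +
    ((1 - Real.cos θ) * (∑ i, x i * y i)) • x

/-- The action of `D₂ₙ` on `V₂(ℝ³)`: `ω·(x,y) = (x, R_x(2π/n)(y))` and `κ·(x,y) = (−x,y)`;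
thus `r k` acts by `(x,y) ↦ (x, R_x(2πk/n)(y))` and `sr k` by `(x,y) ↦ (−x, R_x(2πk/n)(y))`. -/
def actV (n : ℕ) : DihedralGroup n →
    ((Fin 3 → ℝ) × (Fin 3 → ℝ)) → ((Fin 3 → ℝ) × (Fin 3 → ℝ))
  | DihedralGroup.r k => fun p => (p.1, rotAboutAxis p.1 (2 * Real.pi * k.val / n) p.2)
  | DihedralGroup.sr k => fun p => (-p.1, rotAboutAxis p.1 (2 * Real.pi * k.val / n) p.2)

/-- The unit sphere `S² ⊂ ℝ³`. -/
def Sphere2 : Type := {z : Fin 3 → ℝ // ∑ i, z i ^ 2 = 1}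

instance : TopologicalSpace Sphere2 := by unfold Sphere2; infer_instance
instance : MeasurableSpace Sphere2 := by unfold Sphere2; infer_instance

/-- The open angular sector `σᵢ` of the `4`-fan determined by the center `x`, the unit
tangent vector `y ⊥ x` of the first semicircle, and the counterclockwise angles
`θ 0 < θ 1 < θ 2 < θ 3 < θ 0 + 2π` of the four semicircles:  the points at spherical
distance `u ∈ (0,π)` from `x` in a direction of angle `s` strictly between the angles of
`lᵢ` and `lᵢ₊₁`. -/
def fanSector (x y : Fin 3 → ℝ) (θ : Fin 4 → ℝ) (i : Fin 4) : Set (Fin 3 → ℝ) :=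
  {z | ∃ u ∈ Set.Ioo (0 : ℝ) Real.pi,
    ∃ s ∈ Set.Ioo (θ i) (if (i : ℕ) = 3 then θ 0 + 2 * Real.pi else θ (i + 1)),
      z = Real.cos u • x + Real.sin u • rotAboutAxis x s y}

/-- The data `(x, y, θ)` describes a legitimate `4`-fan: `x ∈ S²`, `y` a unit vector
orthogonal to `x`, and strictly counterclockwise-increasing angles within one full turn. -/
def IsFan (x y : Fin 3 → ℝ) (θ : Fin 4 → ℝ) : Prop :=
  (∑ i, x i ^ 2) = 1 ∧ (∑ i, y i ^ 2) = 1 ∧ (∑ i, x i * y i) = 0 ∧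
    θ 0 < θ 1 ∧ θ 1 < θ 2 ∧ θ 2 < θ 3 ∧ θ 3 < θ 0 + 2 * Real.pi

/-- A `4`-fan is a `β`-partition for a measure `μ` on `S²` if `μ(σᵢ) = βᵢ` for each of its
four open angular sectors. -/
def IsFanPartition (x y : Fin 3 → ℝ) (θ : Fin 4 → ℝ) (β : Fin 4 → ℝ)
    (μ : MeasureTheory.Measure Sphere2) : Prop :=
  ∀ i : Fin 4, μ {z : Sphere2 | z.1 ∈ fanSector x y θ i} = ENNReal.ofReal (β i)

/-- A Borel probability measure on `S²` is proper if it vanishes on every circular arc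
(equivalently, on every intersection of `S²` with an affine plane) and is positive on
every nonempty open set. -/
def IsProperMeasure (μ : MeasureTheory.Measure Sphere2) : Prop :=
  (∀ v : Fin 3 → ℝ, v ≠ 0 → ∀ c : ℝ,
    μ {z : Sphere2 | ∑ i, v i * z.1 i = c} = 0) ∧
  (∀ U : Set Sphere2, IsOpen U → U.Nonempty → 0 < μ U)

instance : BorelSpace Sphere2 :=
  inferInstanceAs (BorelSpace {z : Fin 3 → ℝ // ∑ i, z i ^ 2 = 1})

/-! ### Rotations and orthonormal frames -/

theorem rotAboutAxis_eq {x y : Fin 3 → ℝ} (h : (x, y) ∈ V2) (s : ℝ) :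
    rotAboutAxis x s y = Real.cos s • y + Real.sin s • crossProduct x y := by
  have h0 : ∑ i, x i * y i = 0 := h.2.2
  simp [rotAboutAxis, h0]

theorem crossProduct_rotAboutAxis {x y : Fin 3 → ℝ} (h : (x, y) ∈ V2) (s : ℝ) :
    crossProduct x (rotAboutAxis x s y) = Real.cos s • crossProduct x y - Real.sin s • y := by
  have hxx : crossProduct x (crossProduct x y) = -y := by
    obtain ⟨h1, h2, h3⟩ := h
    simp only [Fin.sum_univ_three] at h1 h2 h3
    ext i
    fin_cases i <;> simp [cross_apply]
    · linear_combination (-y 0) * h1 + x 0 * h3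
    · linear_combination (-y 1) * h1 + x 1 * h3
    · linear_combination (-y 2) * h1 + x 2 * h3
  rw [rotAboutAxis_eq h, map_add, map_smul, map_smul, hxx, smul_neg, sub_eq_add_neg]

theorem sum_crossProduct_sq {x y : Fin 3 → ℝ} (h : (x, y) ∈ V2) :
    ∑ i, crossProduct x y i ^ 2 = 1 := by
  obtain ⟨h1, h2, h3⟩ := h
  simp only [Fin.sum_univ_three] at h1 h2 h3
  simp only [Fin.sum_univ_three, cross_apply, Matrix.cons_val]
  linear_combination (y 0 ^ 2 + y 1 ^ 2 + y 2 ^ 2) * h1 + h2 -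
    (x 0 * y 0 + x 1 * y 1 + x 2 * y 2) * h3

theorem rotAboutAxis_mem_V2 {x y : Fin 3 → ℝ} (h : (x, y) ∈ V2) (s : ℝ) :
    (x, rotAboutAxis x s y) ∈ V2 := by
  have hk := sum_crossProduct_sq h
  rw [rotAboutAxis_eq h]
  obtain ⟨h1, h2, h3⟩ := h
  refine ⟨h1, ?_, ?_⟩
  · simp only [Fin.sum_univ_three, cross_apply, Matrix.cons_val, Pi.add_apply, Pi.smul_apply,
      smul_eq_mul] at *
    linear_combination Real.cos s ^ 2 * h2 + Real.sin s ^ 2 * hk + Real.sin_sq_add_cos_sq s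
  · simp only [Fin.sum_univ_three, cross_apply, Matrix.cons_val, Pi.add_apply, Pi.smul_apply,
      smul_eq_mul] at *
    linear_combination Real.cos s * h3

theorem rotAboutAxis_rotAboutAxis {x y : Fin 3 → ℝ} (h : (x, y) ∈ V2) (s t : ℝ) :
    rotAboutAxis x s (rotAboutAxis x t y) = rotAboutAxis x (t + s) y := by
  rw [rotAboutAxis_eq (rotAboutAxis_mem_V2 h t), crossProduct_rotAboutAxis h,
    rotAboutAxis_eq h, rotAboutAxis_eq h]
  ext i
  simp only [Pi.add_apply, Pi.sub_apply, Pi.smul_apply, smul_eq_mul, Real.cos_add, Real.sin_add]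
  ring

theorem rotAboutAxis_zero {x y : Fin 3 → ℝ} : rotAboutAxis x 0 y = y := by
  simp [rotAboutAxis]

theorem rotAboutAxis_add_two_pi (x y : Fin 3 → ℝ) (s : ℝ) :
    rotAboutAxis x (s + 2 * Real.pi) y = rotAboutAxis x s y := by
  simp [rotAboutAxis]

theorem rotAboutAxis_neg_axis (x y : Fin 3 → ℝ) (s : ℝ) :
    rotAboutAxis (-x) s y = rotAboutAxis x (-s) y := by
  simp only [rotAboutAxis, map_neg, LinearMap.neg_apply, Real.cos_neg, Real.sin_neg, Pi.neg_apply,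
    neg_mul, Finset.sum_neg_distrib, mul_neg, smul_neg, neg_smul, neg_neg]

theorem neg_axis_mem_V2 {x y : Fin 3 → ℝ} (h : (x, y) ∈ V2) : (-x, y) ∈ V2 := by
  simpa [V2] using h

/-- The component of `z` in the oriented plane spanned by `y` and `x × y`, as a complex number. -/
def planeCoord (x y z : Fin 3 → ℝ) : ℂ :=
  ⟨∑ i, y i * z i, ∑ i, crossProduct x y i * z i⟩

theorem planeCoord_rotAboutAxis {x y : Fin 3 → ℝ} (h : (x, y) ∈ V2) (s : ℝ) (z : Fin 3 → ℝ) :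
    planeCoord x (rotAboutAxis x s y) z = Complex.exp (-s * Complex.I) * planeCoord x y z := by
  have e : Complex.exp (-s * Complex.I) = ⟨Real.cos s, -Real.sin s⟩ := by
    rw [← Complex.ofReal_neg, Complex.exp_mul_I]
    apply Complex.ext <;> simp [← Complex.ofReal_cos, ← Complex.ofReal_sin]
  rw [e, planeCoord, planeCoord, crossProduct_rotAboutAxis h, rotAboutAxis_eq h]
  apply Complex.ext <;>
  · simp only [Fin.sum_univ_three, Pi.add_apply, Pi.sub_apply, Pi.smul_apply, smul_eq_mul,
      Complex.mul_re, Complex.mul_im]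
    ring

theorem planeCoord_neg_axis (x y z : Fin 3 → ℝ) :
    planeCoord (-x) y z = (starRingEnd ℂ) (planeCoord x y z) := by
  apply Complex.ext <;> simp [planeCoord]

theorem frame_expansion {x y : Fin 3 → ℝ} (h : (x, y) ∈ V2) (z : Fin 3 → ℝ) :
    z = (∑ i, x i * z i) • x + (planeCoord x y z).re • y +
      (planeCoord x y z).im • crossProduct x y := by
  have hk := sum_crossProduct_sq h
  obtain ⟨h1, h2, h3⟩ := h
  have hM : (Matrix.of ![x, y, crossProduct x y]) *
      (Matrix.of ![x, y, crossProduct x y]).transpose = 1 := by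
    simp only [Fin.sum_univ_three] at h1 h2 h3 hk
    ext i j
    fin_cases i <;> fin_cases j <;>
      simp [Matrix.mul_apply, Fin.sum_univ_three] <;> simp [cross_apply] at hk ⊢
    any_goals linear_combination h1
    any_goals linear_combination h2
    any_goals linear_combination h3
    any_goals linear_combination hk
    all_goals ring
  have hM' := mul_eq_one_comm.1 hM
  have hz := congrArg (fun A => Matrix.mulVec A z) hM'
  simp only [← Matrix.mulVec_mulVec, Matrix.one_mulVec] at hz
  ext i
  have hi := congrFun hz i
  simp only [Matrix.mulVec, dotProduct, Fin.sum_univ_three, Matrix.transpose_apply,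
    Matrix.of_apply, Matrix.cons_val] at hi
  simp only [planeCoord, Fin.sum_univ_three, Pi.add_apply, Pi.smul_apply, smul_eq_mul]
  linear_combination -hi

/-! ### Angular sectors -/

theorem arg_neg_polar {ρ θ : ℝ} (hρ : 0 < ρ) (h0 : 0 < θ) (h1 : θ ≤ 2 * Real.pi) :
    Complex.arg (-(ρ * Complex.exp (θ * Complex.I))) = θ - Real.pi := by
  have e : -(ρ * Complex.exp (θ * Complex.I)) =
      ρ * (Complex.cos ((θ - Real.pi : ℝ) : ℂ) + Complex.sin ((θ - Real.pi : ℝ) : ℂ) *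
        Complex.I) := by
    rw [← Complex.exp_mul_I]
    push_cast
    rw [sub_mul, Complex.exp_sub, Complex.exp_pi_mul_I]
    ring
  rw [e, Complex.arg_mul_cos_add_sin_mul_I hρ ⟨by linarith, by linarith⟩]

theorem exists_polar_Ioc (w : ℂ) (s : ℝ) :
    ∃ φ ∈ Set.Ioc s (s + 2 * Real.pi), w = ‖w‖ * Complex.exp (φ * Complex.I) := by
  refine ⟨toIocMod Real.two_pi_pos s w.arg, toIocMod_mem_Ioc _ _ _, ?_⟩
  have : Complex.exp ((toIocMod Real.two_pi_pos s w.arg : ℝ) * Complex.I) =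
      Complex.exp (w.arg * Complex.I) := by
    rw [toIocMod, Complex.exp_eq_exp_iff_exists_int]
    refine ⟨-toIocDiv Real.two_pi_pos s w.arg, ?_⟩
    push_cast [zsmul_eq_mul]
    ring
  rw [this, Complex.norm_mul_exp_arg_mul_I]

/-- The open sector about the axis `x` between the angles `s` and `t` measured from `y`. -/
def angularSector (x y : Fin 3 → ℝ) (s t : ℝ) : Set (Fin 3 → ℝ) :=
  {z | ∃ u ∈ Set.Ioo (0 : ℝ) Real.pi, ∃ r ∈ Set.Ioo s t,
    z = Real.cos u • x + Real.sin u • rotAboutAxis x r y}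

theorem mem_angularSector_iff {x y : Fin 3 → ℝ} (h : (x, y) ∈ V2) {s t : ℝ} {z : Fin 3 → ℝ}
    (hz : ∑ i, z i ^ 2 = 1) :
    z ∈ angularSector x y s t ↔
      ∃ ρ : ℝ, 0 < ρ ∧ ∃ r ∈ Set.Ioo s t, planeCoord x y z = ρ * Complex.exp (r * Complex.I) := by
  have hk := sum_crossProduct_sq h
  have e : ∀ ρ r : ℝ, (ρ * Complex.exp (r * Complex.I) : ℂ) =
      ⟨ρ * Real.cos r, ρ * Real.sin r⟩ := by
    intro ρ r
    rw [Complex.exp_mul_I]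
    apply Complex.ext <;> simp [← Complex.ofReal_cos, ← Complex.ofReal_sin]
  constructor
  · rintro ⟨u, hu, r, hr, rfl⟩
    refine ⟨Real.sin u, Real.sin_pos_of_mem_Ioo hu, r, hr, ?_⟩
    rw [e, rotAboutAxis_eq h]
    obtain ⟨h1, h2, h3⟩ := h
    simp only [Fin.sum_univ_three, cross_apply, Matrix.cons_val] at h1 h2 h3 hk
    apply Complex.ext <;>
      simp only [planeCoord, Fin.sum_univ_three, Pi.add_apply, Pi.smul_apply, smul_eq_mul,
        cross_apply, Matrix.cons_val]
    · linear_combination Real.cos u * h3 + Real.sin u * Real.cos r * h2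
    · linear_combination Real.sin u * Real.sin r * hk
  · rintro ⟨ρ, hρ, r, hr, hw⟩
    have hx := frame_expansion h z
    set c := ∑ i, x i * z i with hc
    rw [hw, e] at hx
    simp only at hx
    have hcρ : c ^ 2 + ρ ^ 2 = 1 := by
      rw [hx] at hz
      obtain ⟨h1, h2, h3⟩ := h
      simp only [Fin.sum_univ_three, cross_apply, Matrix.cons_val, Pi.add_apply, Pi.smul_apply,
        smul_eq_mul] at h1 h2 h3 hk hz
      linear_combination hz - c ^ 2 * h1 - ρ ^ 2 * Real.cos r ^ 2 * h2
        - ρ ^ 2 * Real.sin r ^ 2 * hk - 2 * c * ρ * Real.cos r * h3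
        - ρ ^ 2 * Real.sin_sq_add_cos_sq r
    have hc1 : -1 < c := by nlinarith
    have hc2 : c < 1 := by nlinarith
    refine ⟨Real.arccos c, ⟨Real.arccos_pos.2 hc2, ?_⟩, r, hr, ?_⟩
    · refine lt_of_le_of_ne (Real.arccos_le_pi c) fun h => ?_
      have := Real.arccos_eq_pi.1 h
      linarith
    · have hs : Real.sin (Real.arccos c) = ρ := by
        rw [Real.sin_arccos, show 1 - c ^ 2 = ρ ^ 2 by linarith, Real.sqrt_sq hρ.le]
      rw [Real.cos_arccos hc1.le hc2.le, hs, rotAboutAxis_eq h]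
      nth_rewrite 1 [hx]
      simp only [smul_add, smul_smul, add_assoc]

theorem isOpen_cone {s t : ℝ} (hst : t ≤ s + 2 * Real.pi) :
    IsOpen {w : ℂ | ∃ ρ : ℝ, 0 < ρ ∧ ∃ r ∈ Set.Ioo s t, w = ρ * Complex.exp (r * Complex.I)} := by
  set m := (s + t) / 2 with hm
  have key : {w : ℂ | ∃ ρ : ℝ, 0 < ρ ∧ ∃ r ∈ Set.Ioo s t, w = ρ * Complex.exp (r * Complex.I)} =
      (fun w : ℂ => w * Complex.exp (-m * Complex.I)) ⁻¹'
        (Complex.slitPlane ∩ Complex.arg ⁻¹' Set.Ioo (s - m) (t - m)) := by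
    ext w
    simp only [Set.mem_ofPred_eq, Set.mem_preimage, Set.mem_inter_iff]
    constructor
    · rintro ⟨ρ, hρ, r, ⟨hr1, hr2⟩, rfl⟩
      have e : (ρ : ℂ) * Complex.exp (r * Complex.I) * Complex.exp (-m * Complex.I) =
          ρ * (Complex.cos ((r - m : ℝ) : ℂ) + Complex.sin ((r - m : ℝ) : ℂ) * Complex.I) := by
        rw [← Complex.exp_mul_I, mul_assoc, ← Complex.exp_add]
        push_cast
        ring_nf
      have ha := Complex.arg_mul_cos_add_sin_mul_I hρ
        (θ := r - m) ⟨by linarith, by linarith⟩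
      rw [e, Complex.mem_slitPlane_iff_arg, ha]
      refine ⟨⟨by intro h; linarith, ?_⟩, by linarith, by linarith⟩
      rw [← Complex.exp_mul_I]
      simp [hρ.ne']
    · rintro ⟨h1, h2, h3⟩
      set v := w * Complex.exp (-m * Complex.I) with hv
      refine ⟨‖v‖, norm_pos_iff.2 (Complex.slitPlane_ne_zero h1), v.arg + m,
        ⟨by linarith, by linarith⟩, ?_⟩
      push_cast
      rw [add_mul, Complex.exp_add, ← mul_assoc, Complex.norm_mul_exp_arg_mul_I, hv, mul_assoc,
        ← Complex.exp_add]
      simp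
  rw [key]
  refine IsOpen.preimage (by fun_prop) ?_
  exact ContinuousOn.isOpen_inter_preimage
    (fun _ hw => (Complex.continuousAt_arg hw).continuousWithinAt) Complex.isOpen_slitPlane isOpen_Ioo

theorem continuous_sphere2_val : Continuous (fun z : Sphere2 => z.1) :=
  continuous_subtype_val (p := fun z : Fin 3 → ℝ => ∑ i, z i ^ 2 = 1)

theorem continuous_planeCoord :
    Continuous fun p : (Fin 3 → ℝ) × (Fin 3 → ℝ) × (Fin 3 → ℝ) => planeCoord p.1 p.2.1 p.2.2 := by
  have : (fun p : (Fin 3 → ℝ) × (Fin 3 → ℝ) × (Fin 3 → ℝ) => planeCoord p.1 p.2.1 p.2.2) =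
      fun p => Complex.equivRealProdCLM.symm
        (∑ i, p.2.1 i * p.2.2 i, ∑ i, crossProduct p.1 p.2.1 i * p.2.2 i) := rfl
  rw [this]
  refine Complex.equivRealProdCLM.symm.continuous.comp ?_
  simp only [Fin.sum_univ_three, cross_apply, Matrix.cons_val]
  fun_prop

theorem isOpen_angularSector {x y : Fin 3 → ℝ} (h : (x, y) ∈ V2) {s t : ℝ}
    (hst : t ≤ s + 2 * Real.pi) : IsOpen {z : Sphere2 | z.1 ∈ angularSector x y s t} := by
  have : {z : Sphere2 | z.1 ∈ angularSector x y s t} =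
      (fun z : Sphere2 => planeCoord x y z.1) ⁻¹' {w : ℂ | ∃ ρ : ℝ, 0 < ρ ∧
        ∃ r ∈ Set.Ioo s t, w = ρ * Complex.exp (r * Complex.I)} := by
    ext z
    exact mem_angularSector_iff h z.2
  rw [this]
  refine (isOpen_cone hst).preimage ?_
  exact continuous_planeCoord.comp
    (continuous_const.prodMk (continuous_const.prodMk continuous_sphere2_val))

theorem angularSector_nonempty {x y : Fin 3 → ℝ} (h : (x, y) ∈ V2) {s t : ℝ} (hst : s < t) :
    {z : Sphere2 | z.1 ∈ angularSector x y s t}.Nonempty := by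
  refine ⟨⟨rotAboutAxis x ((s + t) / 2) y, (rotAboutAxis_mem_V2 h _).2.1⟩,
    Real.pi / 2, ⟨by positivity, by linarith [Real.pi_pos]⟩, (s + t) / 2,
    ⟨by linarith, by linarith⟩, ?_⟩
  simp

theorem arg_increment {x y : Fin 3 → ℝ} (h : (x, y) ∈ V2) {s t : ℝ} (hst : s < t)
    (hst' : t ≤ s + 2 * Real.pi) {z : Fin 3 → ℝ} (hz : ∑ i, z i ^ 2 = 1)
    (him : (planeCoord x (rotAboutAxis x t y) z).im ≠ 0) :
    (t + Complex.arg (-planeCoord x (rotAboutAxis x t y) z)) -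
      (s + Complex.arg (-planeCoord x (rotAboutAxis x s y) z)) =
      (angularSector x y s t).indicator (fun _ => 2 * Real.pi) z := by
  have hw0 : planeCoord x y z ≠ 0 := by
    intro h0
    rw [planeCoord_rotAboutAxis h, h0] at him
    simp at him
  obtain ⟨φ, ⟨hφ1, hφ2⟩, hφ⟩ := exists_polar_Ioc (planeCoord x y z) s
  have hρ := norm_pos_iff.2 hw0
  set ρ := ‖planeCoord x y z‖
  have rot : ∀ r : ℝ, planeCoord x (rotAboutAxis x r y) z =
      ρ * Complex.exp ((φ - r : ℝ) * Complex.I) := by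
    intro r
    rw [planeCoord_rotAboutAxis h, hφ, mul_left_comm, ← Complex.exp_add]
    push_cast
    ring_nf
  have rot' : planeCoord x (rotAboutAxis x t y) z =
      ρ * Complex.exp ((φ - t + 2 * Real.pi : ℝ) * Complex.I) := by
    rw [rot]
    congr 1
    rw [Complex.ofReal_add, add_mul, Complex.exp_add]
    simp
  rw [rot s, arg_neg_polar hρ (by linarith) (by linarith)]
  by_cases hφt : φ ≤ t
  · have hne : φ ≠ t := by
      rintro rfl
      rw [rot] at him
      simp at him
    have : z ∈ angularSector x y s t :=
      (mem_angularSector_iff h hz).2 ⟨ρ, hρ, φ, ⟨hφ1, lt_of_le_of_ne hφt hne⟩, hφ⟩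
    rw [Set.indicator_of_mem this, rot', arg_neg_polar hρ (by linarith) (by linarith)]
    ring
  · push Not at hφt
    have : z ∉ angularSector x y s t := by
      intro hmem
      obtain ⟨ρ', hρ', r, ⟨hr1, hr2⟩, hr⟩ := (mem_angularSector_iff h hz).1 hmem
      have e1 := rot s
      rw [planeCoord_rotAboutAxis h, hr, mul_left_comm, ← Complex.exp_add,
        show (-s * Complex.I + r * Complex.I : ℂ) = ((r - s : ℝ) : ℂ) * Complex.I by
          push_cast; ring] at e1
      have e2 := congrArg (fun w => Complex.arg (-w)) e1
      rw [arg_neg_polar hρ' (by linarith) (by linarith),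
        arg_neg_polar hρ (by linarith) (by linarith)] at e2
      linarith
    rw [Set.indicator_of_notMem this, rot t, arg_neg_polar hρ (by linarith) (by linarith)]
    ring

/-! ### The equipartition angle of a measure -/

/-- Rotation of the second vector of an orthonormal frame about the first one. -/
def rotateFrame (s : ℝ) (v : {p // p ∈ V2}) : {p // p ∈ V2} :=
  ⟨(v.1.1, rotAboutAxis v.1.1 s v.1.2), rotAboutAxis_mem_V2 v.2 s⟩

/-- Negation of the axis of an orthonormal frame. -/
def flipFrame (v : {p // p ∈ V2}) : {p // p ∈ V2} :=
  ⟨(-v.1.1, v.1.2), neg_axis_mem_V2 v.2⟩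

theorem rotateFrame_rotateFrame (s t : ℝ) (v : {p // p ∈ V2}) :
    rotateFrame s (rotateFrame t v) = rotateFrame (t + s) v :=
  Subtype.ext (Prod.ext rfl (rotAboutAxis_rotAboutAxis v.2 s t))

theorem rotateFrame_zero (v : {p // p ∈ V2}) : rotateFrame 0 v = v :=
  Subtype.ext (Prod.ext rfl rotAboutAxis_zero)

theorem rotateFrame_add_two_pi (s : ℝ) (v : {p // p ∈ V2}) :
    rotateFrame (s + 2 * Real.pi) v = rotateFrame s v :=
  Subtype.ext (Prod.ext rfl (rotAboutAxis_add_two_pi _ _ _))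

theorem rotateFrame_flipFrame (s : ℝ) (v : {p // p ∈ V2}) :
    rotateFrame s (flipFrame v) = flipFrame (rotateFrame (-s) v) :=
  Subtype.ext (Prod.ext rfl (rotAboutAxis_neg_axis _ _ _))

theorem flipFrame_flipFrame (v : {p // p ∈ V2}) : flipFrame (flipFrame v) = v :=
  Subtype.ext (Prod.ext (neg_neg _) rfl)

theorem continuous_rotateFrame :
    Continuous fun p : ℝ × {p // p ∈ V2} => rotateFrame p.1 p.2 := by
  refine Continuous.subtype_mk ?_ _
  refine Continuous.prodMk (by fun_prop) ?_
  have : (fun p : ℝ × {p // p ∈ V2} => rotAboutAxis p.2.1.1 p.1 p.2.1.2) = fun p =>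
      Real.cos p.1 • p.2.1.2 + Real.sin p.1 • crossProduct p.2.1.1 p.2.1.2 :=
    funext fun p => rotAboutAxis_eq p.2.2 p.1
  rw [this]
  have hc : Continuous fun p : ℝ × {p // p ∈ V2} => crossProduct p.2.1.1 p.2.1.2 := by
    simp only [cross_apply]
    refine continuous_pi fun i => ?_
    fin_cases i <;> simp <;> fun_prop
  fun_prop

/-- The mean angular position of a measure relative to an orthonormal frame `(x, y)`, where angles
are measured in `(-π, π]` from the direction `-y`. -/
def meanAngle (μ : MeasureTheory.Measure Sphere2) (v : {p // p ∈ V2}) : ℝ :=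
  ∫ z : Sphere2, Complex.arg (-planeCoord v.1.1 v.1.2 z.1) ∂μ

/-- The cumulative angular mass function of a measure about the axis of a frame, scaled to total
mass `2π` and normalised so that it does not depend on the position of the frame vector. -/
def cumulativeAngle (μ : MeasureTheory.Measure Sphere2) (v : {p // p ∈ V2}) (s : ℝ) : ℝ :=
  s + meanAngle μ (rotateFrame s v)

theorem cumulativeAngle_rotateFrame (μ : MeasureTheory.Measure Sphere2) (v : {p // p ∈ V2})
    (a s : ℝ) : cumulativeAngle μ (rotateFrame a v) s = cumulativeAngle μ v (a + s) - a := by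
  rw [cumulativeAngle, cumulativeAngle, rotateFrame_rotateFrame]
  ring

section Measure

variable {μ : MeasureTheory.Measure Sphere2}

theorem measurable_arg_planeCoord (x y : Fin 3 → ℝ) :
    Measurable fun z : Sphere2 => Complex.arg (-planeCoord x y z.1) := by
  have : Continuous fun z : Sphere2 => planeCoord x y z.1 := continuous_planeCoord.comp
    (continuous_const.prodMk (continuous_const.prodMk continuous_sphere2_val))
  exact Complex.measurable_arg.comp this.neg.measurable

theorem integrable_arg_planeCoord [MeasureTheory.IsProbabilityMeasure μ] (x y : Fin 3 → ℝ) :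
    MeasureTheory.Integrable (fun z : Sphere2 => Complex.arg (-planeCoord x y z.1)) μ :=
  MeasureTheory.Integrable.of_bound (measurable_arg_planeCoord x y).aestronglyMeasurable Real.pi
    (Filter.Eventually.of_forall fun _ => Complex.abs_arg_le_pi _)

theorem abs_meanAngle_le [MeasureTheory.IsProbabilityMeasure μ] (v : {p // p ∈ V2}) :
    |meanAngle μ v| ≤ Real.pi := by
  have := MeasureTheory.norm_integral_le_of_norm_le_const (μ := μ)
    (f := fun z : Sphere2 => Complex.arg (-planeCoord v.1.1 v.1.2 z.1)) (C := Real.pi)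
    (Filter.Eventually.of_forall fun _ => Complex.abs_arg_le_pi _)
  simpa [meanAngle] using this

theorem IsProperMeasure.ae_im_planeCoord_ne_zero (hμ : IsProperMeasure μ) (v : {p // p ∈ V2}) :
    ∀ᵐ z : Sphere2 ∂μ, (planeCoord v.1.1 v.1.2 z.1).im ≠ 0 := by
  have hk : crossProduct v.1.1 v.1.2 ≠ 0 := by
    intro h0
    have := sum_crossProduct_sq v.2
    simp [h0] at this
  rw [MeasureTheory.ae_iff]
  simpa [planeCoord] using hμ.1 _ hk 0

theorem IsProperMeasure.continuous_meanAngle [MeasureTheory.IsProbabilityMeasure μ]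
    (hμ : IsProperMeasure μ) : Continuous (meanAngle μ) := by
  refine continuous_iff_continuousAt.2 fun v => ?_
  refine MeasureTheory.continuousAt_of_dominated (bound := fun _ => Real.pi)
    (Filter.Eventually.of_forall fun w =>
      (measurable_arg_planeCoord w.1.1 w.1.2).aestronglyMeasurable)
    (Filter.Eventually.of_forall fun w => Filter.Eventually.of_forall fun _ =>
      Complex.abs_arg_le_pi _)
    (MeasureTheory.integrable_const _) ?_
  filter_upwards [hμ.ae_im_planeCoord_ne_zero v] with z hz
  have hc : Continuous fun w : {p // p ∈ V2} => -planeCoord w.1.1 w.1.2 z.1 :=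
    (continuous_planeCoord.comp ((continuous_fst.comp continuous_subtype_val).prodMk
      ((continuous_snd.comp continuous_subtype_val).prodMk continuous_const))).neg
  have hm : -planeCoord v.1.1 v.1.2 z.1 ∈ Complex.slitPlane :=
    Complex.mem_slitPlane_iff.2 (Or.inr (by simpa using hz))
  exact ContinuousAt.comp (f := fun w : {p // p ∈ V2} => -planeCoord w.1.1 w.1.2 z.1)
    (Complex.continuousAt_arg hm) hc.continuousAt

theorem IsProperMeasure.meanAngle_flipFrame (hμ : IsProperMeasure μ) (v : {p // p ∈ V2}) :
    meanAngle μ (flipFrame v) = -meanAngle μ v := by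
  rw [meanAngle, meanAngle, ← MeasureTheory.integral_neg]
  refine MeasureTheory.integral_congr_ae ?_
  filter_upwards [hμ.ae_im_planeCoord_ne_zero v] with z hz
  simp only [flipFrame, planeCoord_neg_axis]
  rw [← map_neg, Complex.arg_conj, if_neg]
  rw [Complex.arg_eq_pi_iff]
  rintro ⟨-, h⟩
  exact hz (by simpa using h)

theorem IsProperMeasure.cumulativeAngle_flipFrame (hμ : IsProperMeasure μ) (v : {p // p ∈ V2})
    (s : ℝ) : cumulativeAngle μ (flipFrame v) s = -cumulativeAngle μ v (-s) := by
  rw [cumulativeAngle, cumulativeAngle, rotateFrame_flipFrame, hμ.meanAngle_flipFrame]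
  ring

theorem IsProperMeasure.cumulativeAngle_sub [MeasureTheory.IsProbabilityMeasure μ]
    (hμ : IsProperMeasure μ) (v : {p // p ∈ V2}) {s t : ℝ} (hst : s < t)
    (hst' : t ≤ s + 2 * Real.pi) :
    cumulativeAngle μ v t - cumulativeAngle μ v s =
      2 * Real.pi * μ.real {z : Sphere2 | z.1 ∈ angularSector v.1.1 v.1.2 s t} := by
  have hint : ∀ r : ℝ, MeasureTheory.Integrable (fun z : Sphere2 =>
      r + Complex.arg (-planeCoord v.1.1 (rotAboutAxis v.1.1 r v.1.2) z.1)) μ := fun r =>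
    (MeasureTheory.integrable_const r).add (integrable_arg_planeCoord _ _)
  have hcum : ∀ r : ℝ, cumulativeAngle μ v r = ∫ z : Sphere2,
      r + Complex.arg (-planeCoord v.1.1 (rotAboutAxis v.1.1 r v.1.2) z.1) ∂μ := by
    intro r
    rw [MeasureTheory.integral_add (MeasureTheory.integrable_const r)
      (integrable_arg_planeCoord _ _)]
    simp [cumulativeAngle, meanAngle, rotateFrame]
  rw [hcum, hcum, ← MeasureTheory.integral_sub (hint t) (hint s)]
  have hae : (fun z : Sphere2 =>
      (t + Complex.arg (-planeCoord v.1.1 (rotAboutAxis v.1.1 t v.1.2) z.1)) -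
      (s + Complex.arg (-planeCoord v.1.1 (rotAboutAxis v.1.1 s v.1.2) z.1))) =ᵐ[μ]
      {z : Sphere2 | z.1 ∈ angularSector v.1.1 v.1.2 s t}.indicator (fun _ => 2 * Real.pi) := by
    filter_upwards [hμ.ae_im_planeCoord_ne_zero (rotateFrame t v)] with z hz
    exact arg_increment v.2 hst hst' z.2 hz
  rw [MeasureTheory.integral_congr_ae hae,
    MeasureTheory.integral_indicator_const _ (isOpen_angularSector v.2 hst').measurableSet,
    smul_eq_mul, mul_comm]

theorem IsProperMeasure.strictMono_cumulativeAngle [MeasureTheory.IsProbabilityMeasure μ]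
    (hμ : IsProperMeasure μ) (v : {p // p ∈ V2}) : StrictMono (cumulativeAngle μ v) := by
  intro s t hst
  rcases le_or_gt t (s + 2 * Real.pi) with h | h
  · have h1 := hμ.cumulativeAngle_sub v hst h
    have h2 := hμ.2 _ (isOpen_angularSector v.2 h) (angularSector_nonempty v.2 hst)
    have h3 : 0 < μ.real {z : Sphere2 | z.1 ∈ angularSector v.1.1 v.1.2 s t} :=
      ENNReal.toReal_pos h2.ne' (MeasureTheory.measure_ne_top _ _)
    have := mul_pos Real.two_pi_pos h3
    linarith
  · have h1 := abs_le.1 (abs_meanAngle_le (μ := μ) (rotateFrame s v))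
    have h2 := abs_le.1 (abs_meanAngle_le (μ := μ) (rotateFrame t v))
    simp only [cumulativeAngle]
    linarith [h1.2, h2.1]

theorem IsProperMeasure.continuous_cumulativeAngle [MeasureTheory.IsProbabilityMeasure μ]
    (hμ : IsProperMeasure μ) :
    Continuous fun p : ℝ × {p // p ∈ V2} => cumulativeAngle μ p.2 p.1 :=
  continuous_fst.add (hμ.continuous_meanAngle.comp continuous_rotateFrame)

theorem IsProperMeasure.exists_cumulativeAngle_eq_zero [MeasureTheory.IsProbabilityMeasure μ]
    (hμ : IsProperMeasure μ) (v : {p // p ∈ V2}) : ∃ s, cumulativeAngle μ v s = 0 := by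
  have hc : Continuous (cumulativeAngle μ v) :=
    hμ.continuous_cumulativeAngle.comp (continuous_id.prodMk continuous_const)
  refine mem_range_of_exists_le_of_exists_ge hc ⟨-Real.pi, ?_⟩ ⟨Real.pi, ?_⟩
  · have := abs_le.1 (abs_meanAngle_le (μ := μ) (rotateFrame (-Real.pi) v))
    simp only [cumulativeAngle]
    linarith [this.2]
  · have := abs_le.1 (abs_meanAngle_le (μ := μ) (rotateFrame Real.pi v))
    simp only [cumulativeAngle]
    linarith [this.1]

/-- The angle at which the normalised cumulative angular mass function vanishes. -/
def rootAngle (μ : MeasureTheory.Measure Sphere2) (v : {p // p ∈ V2}) : ℝ :=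
  Classical.epsilon fun s => cumulativeAngle μ v s = 0

theorem IsProperMeasure.cumulativeAngle_rootAngle [MeasureTheory.IsProbabilityMeasure μ]
    (hμ : IsProperMeasure μ) (v : {p // p ∈ V2}) : cumulativeAngle μ v (rootAngle μ v) = 0 :=
  Classical.epsilon_spec (hμ.exists_cumulativeAngle_eq_zero v)

theorem IsProperMeasure.eq_rootAngle [MeasureTheory.IsProbabilityMeasure μ]
    (hμ : IsProperMeasure μ) {v : {p // p ∈ V2}} {s : ℝ} (hs : cumulativeAngle μ v s = 0) :
    s = rootAngle μ v :=
  (hμ.strictMono_cumulativeAngle v).injective (hs.trans (hμ.cumulativeAngle_rootAngle v).symm)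

theorem IsProperMeasure.continuous_rootAngle [MeasureTheory.IsProbabilityMeasure μ]
    (hμ : IsProperMeasure μ) : Continuous (rootAngle μ) := by
  have hc : ∀ a : ℝ, Continuous fun v => cumulativeAngle μ v a := fun a =>
    hμ.continuous_cumulativeAngle.comp (continuous_const.prodMk continuous_id)
  refine continuous_iff_continuousAt.2 fun v => tendsto_order.2 ⟨fun a ha => ?_, fun a ha => ?_⟩
  · have h := hμ.strictMono_cumulativeAngle v ha
    rw [hμ.cumulativeAngle_rootAngle] at h
    filter_upwards [(hc a).continuousAt.eventually_lt_const h] with w hw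
    rw [← hμ.cumulativeAngle_rootAngle w] at hw
    exact (hμ.strictMono_cumulativeAngle w).lt_iff_lt.1 hw
  · have h := hμ.strictMono_cumulativeAngle v ha
    rw [hμ.cumulativeAngle_rootAngle] at h
    filter_upwards [(hc a).continuousAt.eventually_const_lt h] with w hw
    rw [← hμ.cumulativeAngle_rootAngle w] at hw
    exact (hμ.strictMono_cumulativeAngle w).lt_iff_lt.1 hw

theorem IsProperMeasure.cumulativeAngle_quantile [MeasureTheory.IsProbabilityMeasure μ]
    (hμ : IsProperMeasure μ) (v : {p // p ∈ V2}) (t : ℝ) :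
    cumulativeAngle μ v (t + rootAngle μ (rotateFrame t v)) = t := by
  have := hμ.cumulativeAngle_rootAngle (rotateFrame t v)
  rw [cumulativeAngle_rotateFrame] at this
  linarith

theorem IsProperMeasure.rootAngle_flipFrame [MeasureTheory.IsProbabilityMeasure μ]
    (hμ : IsProperMeasure μ) (v : {p // p ∈ V2}) :
    rootAngle μ (flipFrame v) = -rootAngle μ v := by
  refine (hμ.eq_rootAngle ?_).symm
  rw [hμ.cumulativeAngle_flipFrame, neg_neg, hμ.cumulativeAngle_rootAngle, neg_zero]

/-! ### The test map -/

/-- The discrepancy between two measures, as measured by the cumulative angular mass of `ν` at the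
ray where that of `μ` vanishes. -/
def discrepancy (μ ν : MeasureTheory.Measure Sphere2) (v : {p // p ∈ V2}) : ℝ :=
  cumulativeAngle ν v (rootAngle μ v)

variable {ν : MeasureTheory.Measure Sphere2}

theorem continuous_discrepancy [MeasureTheory.IsProbabilityMeasure μ]
    [MeasureTheory.IsProbabilityMeasure ν] (hμ : IsProperMeasure μ) (hν : IsProperMeasure ν) :
    Continuous (discrepancy μ ν) :=
  hν.continuous_cumulativeAngle.comp (hμ.continuous_rootAngle.prodMk continuous_id)

theorem discrepancy_flipFrame [MeasureTheory.IsProbabilityMeasure μ]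
    (hμ : IsProperMeasure μ) (hν : IsProperMeasure ν) (v : {p // p ∈ V2}) :
    discrepancy μ ν (flipFrame v) = -discrepancy μ ν v := by
  rw [discrepancy, discrepancy, hν.cumulativeAngle_flipFrame, hμ.rootAngle_flipFrame, neg_neg]

/-- The discrepancy at the frame rotated by the fraction `r / n` of a full turn. -/
def discrepancyAt (n : ℕ) (μ ν : MeasureTheory.Measure Sphere2) (v : {p // p ∈ V2}) (r : ℝ) : ℝ :=
  discrepancy μ ν (rotateFrame (2 * Real.pi * r / n) v)

theorem discrepancyAt_add_card {n : ℕ} (hn : n ≠ 0) (v : {p // p ∈ V2}) (r : ℝ) :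
    discrepancyAt n μ ν v (r + n) = discrepancyAt n μ ν v r := by
  have : (2 * Real.pi * (r + n) / n : ℝ) = 2 * Real.pi * r / n + 2 * Real.pi := by
    field_simp
  rw [discrepancyAt, this, rotateFrame_add_two_pi, discrepancyAt]

theorem discrepancyAt_rotateFrame (n : ℕ) (v : {p // p ∈ V2}) (k r : ℝ) :
    discrepancyAt n μ ν (rotateFrame (2 * Real.pi * k / n) v) r =
      discrepancyAt n μ ν v (r + k) := by
  rw [discrepancyAt, rotateFrame_rotateFrame, discrepancyAt]
  congr 2
  ring

theorem discrepancyAt_flipFrame [MeasureTheory.IsProbabilityMeasure μ] (n : ℕ)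
    (hμ : IsProperMeasure μ) (hν : IsProperMeasure ν) (v : {p // p ∈ V2}) (r : ℝ) :
    discrepancyAt n μ ν (flipFrame v) r = -discrepancyAt n μ ν v (-r) := by
  rw [discrepancyAt, rotateFrame_flipFrame, discrepancy_flipFrame hμ hν, discrepancyAt]
  congr 3
  ring

/-- The vector of increments of the discrepancy along the `n` rays of an equipartition of `μ`. -/
def testMap (n : ℕ) (μ ν : MeasureTheory.Measure Sphere2) (v : {p // p ∈ V2}) : Fin n → ℝ :=
  fun i => discrepancyAt n μ ν v ((i : ℕ) + 1) - discrepancyAt n μ ν v (i : ℕ)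

theorem continuous_testMap [MeasureTheory.IsProbabilityMeasure μ]
    [MeasureTheory.IsProbabilityMeasure ν] (n : ℕ) (hμ : IsProperMeasure μ)
    (hν : IsProperMeasure ν) : Continuous (testMap n μ ν) := by
  have h : ∀ r : ℝ, Continuous fun v => discrepancyAt n μ ν v r := fun r =>
    (continuous_discrepancy hμ hν).comp
      (continuous_rotateFrame.comp (continuous_const.prodMk continuous_id))
  exact continuous_pi fun i => (h _).sub (h _)

theorem sum_testMap_filter {n a b : ℕ} (hab : a ≤ b) (hb : b ≤ n) (v : {p // p ∈ V2}) :
    ∑ i ∈ Finset.univ.filter (fun i : Fin n => a ≤ (i : ℕ) ∧ (i : ℕ) < b), testMap n μ ν v i =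
      discrepancyAt n μ ν v b - discrepancyAt n μ ν v a := by
  have hf : ∑ i ∈ Finset.univ.filter (fun i : Fin n => a ≤ (i : ℕ) ∧ (i : ℕ) < b),
      testMap n μ ν v i = ∑ j ∈ Finset.Ico a b,
        (discrepancyAt n μ ν v ((j + 1 : ℕ) : ℝ) - discrepancyAt n μ ν v (j : ℕ)) := by
    refine Finset.sum_bij (fun i _ => (i : ℕ)) ?_ ?_ ?_ ?_
    · intro i hi
      simpa using hi
    · intro i _ j _ hij
      exact Fin.ext hij
    · intro j hj
      have hj' := Finset.mem_Ico.1 hj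
      exact ⟨⟨j, hj'.2.trans_le hb⟩, by simpa using hj', rfl⟩
    · intro i _
      simp [testMap]
  rw [hf, Finset.sum_Ico_sub (fun j : ℕ => discrepancyAt n μ ν v (j : ℝ)) hab]

theorem testMap_mem_Wset {n : ℕ} (hn : n ≠ 0) (v : {p // p ∈ V2}) : testMap n μ ν v ∈ Wset n := by
  have h := sum_testMap_filter (μ := μ) (ν := ν) (Nat.zero_le n) le_rfl v
  have h' := discrepancyAt_add_card (μ := μ) (ν := ν) hn v 0
  rw [zero_add] at h'
  simpa [h', Wset] using h

theorem cyclicShift_testMap {n : ℕ} (hn : n ≠ 0) (v : {p // p ∈ V2}) :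
    cyclicShift n (testMap n μ ν v) = testMap n μ ν (rotateFrame (2 * Real.pi * 1 / n) v) := by
  obtain ⟨m, rfl⟩ := Nat.exists_eq_succ_of_ne_zero hn
  ext i
  simp only [cyclicShift, testMap, discrepancyAt_rotateFrame]
  by_cases h : i = Fin.last m
  · subst h
    have h0 : ((finRotate (m + 1) (Fin.last m) : Fin (m + 1)) : ℕ) = 0 := by simp
    have h1 := discrepancyAt_add_card (μ := μ) (ν := ν) hn v 0
    have h2 := discrepancyAt_add_card (μ := μ) (ν := ν) hn v 1
    simp only [Nat.succ_eq_add_one, Nat.cast_add, Nat.cast_one, zero_add] at h1 h2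
    simp only [Nat.succ_eq_add_one, h0, Fin.val_last, Nat.cast_zero, zero_add]
    rw [h1, show (m : ℝ) + 1 + 1 = 1 + (m + 1) by ring, h2]
  · have hi := coe_finRotate i
    rw [if_neg h] at hi
    rw [hi, Nat.cast_add, Nat.cast_one]

theorem iterate_cyclicShift_testMap {n : ℕ} (hn : n ≠ 0) (v : {p // p ∈ V2}) (k : ℕ) :
    (cyclicShift n)^[k] (testMap n μ ν v) =
      testMap n μ ν (rotateFrame (2 * Real.pi * k / n) v) := by
  induction k with
  | zero => simp [rotateFrame_zero]
  | succ k ih =>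
    rw [Function.iterate_succ_apply', ih, cyclicShift_testMap hn, rotateFrame_rotateFrame]
    congr 2
    push_cast
    ring

theorem revShift_testMap [MeasureTheory.IsProbabilityMeasure μ] {n : ℕ} (hn : n ≠ 0)
    (hμ : IsProperMeasure μ) (hν : IsProperMeasure ν) (v : {p // p ∈ V2}) :
    revShift n (testMap n μ ν v) = testMap n μ ν (flipFrame v) := by
  ext i
  have hr : ((i.rev : ℕ) : ℝ) = n - (i + 1) := by
    rw [Fin.val_rev, Nat.cast_sub (by omega)]
    push_cast
    ring
  simp only [revShift, testMap, discrepancyAt_flipFrame n hμ hν, hr]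
  rw [← discrepancyAt_add_card hn v (-((i : ℕ) : ℝ)), ← discrepancyAt_add_card hn v (-(_ + 1))]
  ring_nf

/-- The action of the dihedral group on orthonormal frames. -/
def frameAct (n : ℕ) : DihedralGroup n → {p // p ∈ V2} → {p // p ∈ V2}
  | DihedralGroup.r k => rotateFrame (2 * Real.pi * k.val / n)
  | DihedralGroup.sr k => fun v => flipFrame (rotateFrame (2 * Real.pi * k.val / n) v)

theorem coe_frameAct (n : ℕ) (g : DihedralGroup n) (v : {p // p ∈ V2}) :
    (frameAct n g v : (Fin 3 → ℝ) × (Fin 3 → ℝ)) = actV n g v.1 := by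
  cases g <;> rfl

theorem frameAct_surjective (n : ℕ) (g : DihedralGroup n) :
    Function.Surjective (frameAct n g) := by
  have hrot : ∀ s, Function.Surjective (rotateFrame s) := fun s v =>
    ⟨rotateFrame (-s) v, by rw [rotateFrame_rotateFrame, neg_add_cancel, rotateFrame_zero]⟩
  cases g with
  | r k => exact hrot _
  | sr k => exact (Function.Involutive.surjective flipFrame_flipFrame).comp (hrot _)

theorem actW_injective (n : ℕ) (g : DihedralGroup n) : Function.Injective (actW n g) := by
  have hs : Function.Injective (cyclicShift n) := (finRotate n).surjective.injective_comp_right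
  have hr : Function.Injective (revShift n) := Fin.rev_surjective.injective_comp_right
  cases g with
  | r k => exact hs.iterate _
  | sr k => exact hr.comp (hs.iterate _)

theorem testMap_frameAct [MeasureTheory.IsProbabilityMeasure μ] {n : ℕ} (hn : n ≠ 0)
    (hμ : IsProperMeasure μ) (hν : IsProperMeasure ν) (g : DihedralGroup n) (v : {p // p ∈ V2}) :
    testMap n μ ν (frameAct n g v) = actW n g (testMap n μ ν v) := by
  cases g with
  | r k => exact (iterate_cyclicShift_testMap hn v _).symm
  | sr k =>
    simp only [frameAct, actW]
    rw [iterate_cyclicShift_testMap hn, revShift_testMap hn hμ hν]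

/-- The angle of the ray at the `r`-th step of the equipartition of `μ` into `n` sectors. -/
def quantileAngle (n : ℕ) (μ : MeasureTheory.Measure Sphere2) (v : {p // p ∈ V2}) (r : ℝ) : ℝ :=
  2 * Real.pi * r / n + rootAngle μ (rotateFrame (2 * Real.pi * r / n) v)

theorem quantileAngle_add_card {n : ℕ} (hn : n ≠ 0) (v : {p // p ∈ V2}) (r : ℝ) :
    quantileAngle n μ v (r + n) = quantileAngle n μ v r + 2 * Real.pi := by
  have : (2 * Real.pi * (r + n) / n : ℝ) = 2 * Real.pi * r / n + 2 * Real.pi := by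
    field_simp
  rw [quantileAngle, this, rotateFrame_add_two_pi, quantileAngle]
  ring

theorem cumulativeAngle_quantileAngle [MeasureTheory.IsProbabilityMeasure μ]
    (hμ : IsProperMeasure μ) (n : ℕ) (v : {p // p ∈ V2}) (r : ℝ) :
    cumulativeAngle μ v (quantileAngle n μ v r) = 2 * Real.pi * r / n :=
  hμ.cumulativeAngle_quantile v _

theorem cumulativeAngle_quantileAngle_eq_discrepancyAt (n : ℕ) (v : {p // p ∈ V2}) (r : ℝ) :
    cumulativeAngle ν v (quantileAngle n μ v r) =
      2 * Real.pi * r / n + discrepancyAt n μ ν v r := by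
  rw [discrepancyAt, discrepancy, cumulativeAngle_rotateFrame, quantileAngle]
  ring

theorem strictMono_quantileAngle [MeasureTheory.IsProbabilityMeasure μ]
    (hμ : IsProperMeasure μ) {n : ℕ} (hn : n ≠ 0) (v : {p // p ∈ V2}) :
    StrictMono (quantileAngle n μ v) := by
  intro r s hrs
  rw [← (hμ.strictMono_cumulativeAngle v).lt_iff_lt, cumulativeAngle_quantileAngle hμ,
    cumulativeAngle_quantileAngle hμ]
  have : (0 : ℝ) < n := by positivity
  have := Real.pi_pos
  gcongr

theorem measure_angularSector_eq [MeasureTheory.IsProbabilityMeasure μ]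
    (hμ : IsProperMeasure μ) (v : {p // p ∈ V2}) {s t c : ℝ} (hst : s < t)
    (hst' : t ≤ s + 2 * Real.pi)
    (hc : cumulativeAngle μ v t - cumulativeAngle μ v s = 2 * Real.pi * c) :
    μ {z : Sphere2 | z.1 ∈ angularSector v.1.1 v.1.2 s t} = ENNReal.ofReal c := by
  rw [hμ.cumulativeAngle_sub v hst hst'] at hc
  rw [← mul_left_cancel₀ Real.two_pi_pos.ne' hc, MeasureTheory.Measure.real, ENNReal.ofReal_toReal]
  exact MeasureTheory.measure_ne_top _ _

theorem measure_quantile_sectors [MeasureTheory.IsProbabilityMeasure μ]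
    [MeasureTheory.IsProbabilityMeasure ν] (hμ : IsProperMeasure μ) (hν : IsProperMeasure ν)
    {n : ℕ} (hn : n ≠ 0) (v : {p // p ∈ V2}) {a b : ℝ} (hab : a < b) (hbn : b ≤ a + n)
    (hd : discrepancyAt n μ ν v b - discrepancyAt n μ ν v a = 0) :
    μ {z : Sphere2 | z.1 ∈ angularSector v.1.1 v.1.2 (quantileAngle n μ v a)
        (quantileAngle n μ v b)} = ENNReal.ofReal ((b - a) / n) ∧
      ν {z : Sphere2 | z.1 ∈ angularSector v.1.1 v.1.2 (quantileAngle n μ v a)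
        (quantileAngle n μ v b)} = ENNReal.ofReal ((b - a) / n) := by
  have hm := strictMono_quantileAngle hμ hn v
  have hle : quantileAngle n μ v b ≤ quantileAngle n μ v a + 2 * Real.pi := by
    rw [← quantileAngle_add_card hn]
    exact hm.monotone hbn
  constructor
  · refine measure_angularSector_eq hμ v (hm hab) hle ?_
    rw [cumulativeAngle_quantileAngle hμ, cumulativeAngle_quantileAngle hμ]
    ring
  · refine measure_angularSector_eq hν v (hm hab) hle ?_
    rw [cumulativeAngle_quantileAngle_eq_discrepancyAt,
      cumulativeAngle_quantileAngle_eq_discrepancyAt]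
    linear_combination hd

end Measure

/-- Let `G ≤ D₂ₙ`. If there is no continuous `G`-equivariant map
`F : V₂(ℝ³) → M_G(α)`, then for every pair `μ, ν` of proper Borel probability measures on
`S²` there exists a `4`-fan which is an `(a₁/n, a₂/n, a₃/n, a₄/n)`-partition for both `μ`
and `ν`. -/
theorem fan_partition_of_no_equivariant_map (n a₁ a₂ a₃ a₄ : ℕ) (hn : 1 ≤ n)
    (h1 : 0 < a₁) (h2 : 0 < a₂) (h3 : 0 < a₃) (h4 : 0 < a₄)
    (hsum : a₁ + a₂ + a₃ + a₄ = n) (G : Subgroup (DihedralGroup n))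
    (hmap : ¬ ∃ F : {p // p ∈ V2} → (Fin n → ℝ),
      Continuous F ∧ (∀ v, F v ∈ MG n a₁ a₂ a₃ a₄ G) ∧
      ∀ g : DihedralGroup n, g ∈ G → ∀ v : {p // p ∈ V2}, ∀ h : actV n g v.1 ∈ V2,
        F ⟨actV n g v.1, h⟩ = actW n g (F v))
    (μ ν : MeasureTheory.Measure Sphere2)
    (hμP : MeasureTheory.IsProbabilityMeasure μ) (hνP : MeasureTheory.IsProbabilityMeasure ν)
    (hμ : IsProperMeasure μ) (hν : IsProperMeasure ν) :
    ∃ (x y : Fin 3 → ℝ) (θ : Fin 4 → ℝ), IsFan x y θ ∧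
      IsFanPartition x y θ (fun i => (![a₁, a₂, a₃, a₄] i : ℝ) / n) μ ∧
      IsFanPartition x y θ (fun i => (![a₁, a₂, a₃, a₄] i : ℝ) / n) ν := by
  have hn0 : n ≠ 0 := by omega
  obtain ⟨v, hv⟩ : ∃ v, testMap n μ ν v ∈ Lset n a₁ a₂ a₃ a₄ := by
    by_contra! hcon
    refine hmap ⟨testMap n μ ν, continuous_testMap n hμ hν, fun v => ⟨testMap_mem_Wset hn0 v, ?_⟩,
      fun g _ v h => ?_⟩
    · intro hmem
      simp only [GArrangementUnion, Set.mem_iUnion] at hmem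
      obtain ⟨g, -, w, hw, hgw⟩ := hmem
      obtain ⟨v', rfl⟩ := frameAct_surjective n g v
      rw [testMap_frameAct hn0 hμ hν] at hgw
      exact hcon v' (actW_injective n g hgw ▸ hw)
    · rw [← testMap_frameAct hn0 hμ hν]
      exact congrArg _ (Subtype.ext (coe_frameAct n g v).symm)
  obtain ⟨-, e1, e2, e3, e4⟩ := hv
  have f1 : ∀ i : Fin n, (i : ℕ) < a₁ ↔ 0 ≤ (i : ℕ) ∧ (i : ℕ) < a₁ := fun i => by omega
  have f4 : ∀ i : Fin n, a₁ + a₂ + a₃ ≤ (i : ℕ) ↔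
      a₁ + a₂ + a₃ ≤ (i : ℕ) ∧ (i : ℕ) < n := fun i => by omega
  rw [Finset.filter_congr fun i _ => f1 i] at e1
  rw [Finset.filter_congr fun i _ => f4 i] at e4
  rw [sum_testMap_filter (by omega) (by omega)] at e1 e2 e3 e4
  have hq := strictMono_quantileAngle hμ hn0 v
  have hqn : quantileAngle n μ v n = quantileAngle n μ v (0 : ℕ) + 2 * Real.pi := by
    rw [← quantileAngle_add_card hn0]
    simp
  have key : ∀ a b : ℕ, a < b → b ≤ n →
      discrepancyAt n μ ν v b - discrepancyAt n μ ν v a = 0 → _ := fun a b hab hb hd =>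
    measure_quantile_sectors hμ hν hn0 v (a := a) (b := b) (by exact_mod_cast hab)
      (by exact_mod_cast hb.trans (Nat.le_add_left n a)) hd
  have m1 := key 0 a₁ (by omega) (by omega) e1
  have m2 := key a₁ (a₁ + a₂) (by omega) (by omega) e2
  have m3 := key (a₁ + a₂) (a₁ + a₂ + a₃) (by omega) (by omega) e3
  have m4 := key (a₁ + a₂ + a₃) n (by omega) (by omega) e4
  rw [hqn] at m4
  rw [show ((a₁ : ℕ) : ℝ) - (0 : ℕ) = a₁ by simp] at m1
  rw [show ((a₁ + a₂ : ℕ) : ℝ) - a₁ = a₂ by push_cast; ring] at m2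
  rw [show ((a₁ + a₂ + a₃ : ℕ) : ℝ) - (a₁ + a₂ : ℕ) = a₃ by push_cast; ring] at m3
  rw [show (n : ℝ) - (a₁ + a₂ + a₃ : ℕ) = a₄ by rw [← hsum]; push_cast; ring] at m4
  have q : ∀ a b : ℕ, a < b → quantileAngle n μ v a < quantileAngle n μ v b := fun a b hab =>
    hq (by exact_mod_cast hab)
  refine ⟨v.1.1, v.1.2, ![quantileAngle n μ v (0 : ℕ), quantileAngle n μ v a₁,
    quantileAngle n μ v (a₁ + a₂ : ℕ), quantileAngle n μ v (a₁ + a₂ + a₃ : ℕ)],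
    ⟨v.2.1, v.2.2.1, v.2.2.2, q _ _ (by omega), q _ _ (by omega), q _ _ (by omega), ?_⟩, ?_, ?_⟩
  · exact (q _ n (by omega)).trans_eq hqn
  · intro i
    fin_cases i
    · exact m1.1
    · exact m2.1
    · exact m3.1
    · exact m4.1
  · intro i
    fin_cases i
    · exact m1.2
    · exact m2.2
    · exact m3.2
    · exact m4.2
end
end

section
/- There exists a continuous D₂ₙ-equivariant map G : V₂(ℝ³) → M_D(α) if and only if there exists a continuous Q₄ₙ-equivariant map F : S³ → M_D(α). -/
noncomputable section

open scoped BigOperators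

/-- The union `⋃ A_D(α)` of the smallest family of linear subspaces containing `L(α)`
that is invariant under the cyclic shift `σ` and the reversal `τ`; it consists of the
subspaces `σᵏ·L(α)` and `σᵏ·(τ·L(α))`, `0 ≤ k < n`. -/
def dihArrangementUnion (n a₁ a₂ a₃ a₄ : ℕ) : Set (Fin n → ℝ) :=
  (⋃ k ∈ Finset.range n, (cyclicShift n)^[k] '' Lset n a₁ a₂ a₃ a₄) ∪
  (⋃ k ∈ Finset.range n, (cyclicShift n)^[k] '' (revShift n '' Lset n a₁ a₂ a₃ a₄))

/-- The complement `M_D(α) = Wₙ \ ⋃ A_D(α)`. -/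
def Mdih (n a₁ a₂ a₃ a₄ : ℕ) : Set (Fin n → ℝ) :=
  Wset n \ dihArrangementUnion n a₁ a₂ a₃ a₄

/-- The quaternion `ε = cos(π/n) + i·sin(π/n)`. -/
def epsQ (n : ℕ) : Quaternion ℝ :=
  ⟨Real.cos (Real.pi / n), Real.sin (Real.pi / n), 0, 0⟩

/-- The quaternion `j`. -/
def jQ : Quaternion ℝ := ⟨0, 0, 1, 0⟩

lemma norm_epsQ (n : ℕ) : ‖epsQ n‖ = 1 := by
  have h : Quaternion.normSq (epsQ n) = 1 := by
    rw [Quaternion.normSq_def']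
    show Real.cos (Real.pi / n) ^ 2 + Real.sin (Real.pi / n) ^ 2 + 0 ^ 2 + 0 ^ 2 = 1
    have := Real.cos_sq_add_sin_sq (Real.pi / n)
    nlinarith
  have h2 := Quaternion.normSq_eq_norm_mul_self (epsQ n)
  rw [h] at h2
  nlinarith [norm_nonneg (epsQ n)]

lemma norm_jQ : ‖jQ‖ = 1 := by
  have h : Quaternion.normSq jQ = 1 := by
    rw [Quaternion.normSq_def']
    show (0:ℝ) ^ 2 + 0 ^ 2 + 1 ^ 2 + 0 ^ 2 = 1
    norm_num
  have h2 := Quaternion.normSq_eq_norm_mul_self jQ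
  rw [h] at h2
  nlinarith [norm_nonneg jQ]

/-- The sphere `S³` of unit quaternions. -/
abbrev UnitQuat : Type := {q : Quaternion ℝ // ‖q‖ = 1}

/-- Existence of a continuous `Q₄ₙ`-equivariant map `S³ → M_D(α)`: equivariance with respect
to the generators `ε` (acting on `Wₙ` as `σ`) and `j` (acting as `τ`). -/
def ExistsQuatEquivariantMap (n a₁ a₂ a₃ a₄ : ℕ) : Prop :=
  ∃ F : UnitQuat → {x : Fin n → ℝ // x ∈ Mdih n a₁ a₂ a₃ a₄},
    Continuous F ∧
    (∀ q : UnitQuat,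
      (F ⟨epsQ n * q.1, by rw [norm_mul, norm_epsQ, q.2, one_mul]⟩).1
        = cyclicShift n (F q).1) ∧
    (∀ q : UnitQuat,
      (F ⟨jQ * q.1, by rw [norm_mul, norm_jQ, q.2, one_mul]⟩).1
        = revShift n (F q).1)

/-- The action of the generator `ω` of `D₂ₙ` on `V₂(ℝ³)`: `ω·(x,y) = (x, R_x(2π/n)(y))`. -/
def omegaV (n : ℕ) (p : (Fin 3 → ℝ) × (Fin 3 → ℝ)) : (Fin 3 → ℝ) × (Fin 3 → ℝ) :=
  (p.1, rotAboutAxis p.1 (2 * Real.pi / n) p.2)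

/-- The action of the generator `κ` of `D₂ₙ` on `V₂(ℝ³)`: `κ·(x,y) = (−x, y)`. -/
def kappaV (p : (Fin 3 → ℝ) × (Fin 3 → ℝ)) : (Fin 3 → ℝ) × (Fin 3 → ℝ) :=
  (-p.1, p.2)

/-- Existence of a continuous `D₂ₙ`-equivariant map `V₂(ℝ³) → M_D(α)`: equivariance with
respect to the generators `ω` (acting on `Wₙ` as `σ`) and `κ` (acting as `τ`). -/
def ExistsDihedralEquivariantMap (n a₁ a₂ a₃ a₄ : ℕ) : Prop :=
  ∃ G : {p // p ∈ V2} → {x : Fin n → ℝ // x ∈ Mdih n a₁ a₂ a₃ a₄},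
    Continuous G ∧
    (∀ v : {p // p ∈ V2}, ∀ h : omegaV n v.1 ∈ V2,
      (G ⟨omegaV n v.1, h⟩).1 = cyclicShift n (G v).1) ∧
    (∀ v : {p // p ∈ V2}, ∀ h : kappaV v.1 ∈ V2,
      (G ⟨kappaV v.1, h⟩).1 = revShift n (G v).1)

section QuaternionFrames

open scoped Quaternion

/-- The pure quaternion with imaginary part `v`. -/
def pureQuat (v : Fin 3 → ℝ) : Quaternion ℝ := ⟨0, v 0, v 1, v 2⟩

/-- The imaginary part of a quaternion, as a vector of `ℝ³`. -/
def imVec (q : Quaternion ℝ) : Fin 3 → ℝ := ![q.imI, q.imJ, q.imK]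

/-- The quaternion `i`. -/
def iQ : Quaternion ℝ := ⟨0, 1, 0, 0⟩

@[simp] lemma pureQuat_re (v : Fin 3 → ℝ) : (pureQuat v).re = 0 := rfl
@[simp] lemma pureQuat_imI (v : Fin 3 → ℝ) : (pureQuat v).imI = v 0 := rfl
@[simp] lemma pureQuat_imJ (v : Fin 3 → ℝ) : (pureQuat v).imJ = v 1 := rfl
@[simp] lemma pureQuat_imK (v : Fin 3 → ℝ) : (pureQuat v).imK = v 2 := rfl

@[simp] lemma iQ_re : iQ.re = 0 := rfl
@[simp] lemma iQ_imI : iQ.imI = 1 := rfl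
@[simp] lemma iQ_imJ : iQ.imJ = 0 := rfl
@[simp] lemma iQ_imK : iQ.imK = 0 := rfl

@[simp] lemma jQ_re : jQ.re = 0 := rfl
@[simp] lemma jQ_imI : jQ.imI = 0 := rfl
@[simp] lemma jQ_imJ : jQ.imJ = 1 := rfl
@[simp] lemma jQ_imK : jQ.imK = 0 := rfl

@[simp] lemma epsQ_re (n : ℕ) : (epsQ n).re = Real.cos (Real.pi / n) := rfl
@[simp] lemma epsQ_imI (n : ℕ) : (epsQ n).imI = Real.sin (Real.pi / n) := rfl
@[simp] lemma epsQ_imJ (n : ℕ) : (epsQ n).imJ = 0 := rfl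
@[simp] lemma epsQ_imK (n : ℕ) : (epsQ n).imK = 0 := rfl

/-- The frame `(-q⁻¹iq, q⁻¹jq)` attached to a unit quaternion `q`. -/
def quatFrame (q : Quaternion ℝ) : (Fin 3 → ℝ) × (Fin 3 → ℝ) :=
  (-imVec (star q * iQ * q), imVec (star q * jQ * q))

lemma sum_sq_eq_one {q : Quaternion ℝ} (hq : ‖q‖ = 1) :
    q.re ^ 2 + q.imI ^ 2 + q.imJ ^ 2 + q.imK ^ 2 = 1 := by
  rw [← Quaternion.normSq_def', Quaternion.normSq_eq_norm_mul_self, hq, one_mul]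

lemma star_mul_self_of_norm_eq_one {q : Quaternion ℝ} (hq : ‖q‖ = 1) : star q * q = 1 := by
  rw [Quaternion.star_mul_self, Quaternion.normSq_eq_norm_mul_self, hq, one_mul,
    Quaternion.coe_one]

lemma self_mul_star_of_norm_eq_one {q : Quaternion ℝ} (hq : ‖q‖ = 1) : q * star q = 1 := by
  rw [Quaternion.self_mul_star, Quaternion.normSq_eq_norm_mul_self, hq, one_mul,
    Quaternion.coe_one]

lemma quatFrame_mem_V2 {q : Quaternion ℝ} (hq : ‖q‖ = 1) : quatFrame q ∈ V2 := by
  have h := sum_sq_eq_one hq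
  have h' : (q.re ^ 2 + q.imI ^ 2 + q.imJ ^ 2 + q.imK ^ 2) ^ 2 = 1 := by rw [h, one_pow]
  refine ⟨?_, ?_, ?_⟩ <;>
    simp [quatFrame, imVec, Fin.sum_univ_three]
  · linear_combination h'
  · linear_combination h'
  · ring

lemma continuous_quatFrame : Continuous quatFrame := by
  have h (p : Quaternion ℝ) : Continuous fun q : Quaternion ℝ => imVec (star q * p * q) := by
    have hc : Continuous fun q : Quaternion ℝ => star q * p * q := by fun_prop
    refine continuous_pi fun i => ?_
    fin_cases i
    · exact Quaternion.continuous_imI.comp hc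
    · exact Quaternion.continuous_imJ.comp hc
    · exact Quaternion.continuous_imK.comp hc
  exact (h iQ).neg.prodMk (h jQ)

lemma quatFrame_epsQ_mul (n : ℕ) {q : Quaternion ℝ} (hq : ‖q‖ = 1) :
    quatFrame (epsQ n * q) = omegaV n (quatFrame q) := by
  have h := sum_sq_eq_one hq
  have hV := (quatFrame_mem_V2 hq).2.2
  have hcs := Real.cos_sq_add_sin_sq (Real.pi / n)
  have hc : Real.cos (2 * Real.pi / n) =
      Real.cos (Real.pi / n) ^ 2 - Real.sin (Real.pi / n) ^ 2 := by
    rw [mul_div_assoc, Real.cos_two_mul']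
  have hs : Real.sin (2 * Real.pi / n) =
      2 * Real.sin (Real.pi / n) * Real.cos (Real.pi / n) := by
    rw [mul_div_assoc, Real.sin_two_mul]
  refine Prod.ext ?_ ?_
  · ext i
    fin_cases i <;> simp [quatFrame, omegaV, imVec]
    · linear_combination (-(q.re ^ 2 + q.imI ^ 2 - q.imJ ^ 2 - q.imK ^ 2)) * hcs
    · linear_combination (-2 * (q.imI * q.imJ - q.re * q.imK)) * hcs
    · linear_combination (-2 * (q.imI * q.imK + q.re * q.imJ)) * hcs
  · ext i
    simp only [omegaV, rotAboutAxis, hV, hc, hs]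
    fin_cases i <;> simp [quatFrame, imVec, crossProduct]
    · linear_combination 2 * Real.sin (Real.pi / n) * Real.cos (Real.pi / n) *
        (2 * (q.imI * q.imK - q.re * q.imJ)) * h
    · linear_combination 2 * Real.sin (Real.pi / n) * Real.cos (Real.pi / n) *
        (2 * (q.imJ * q.imK + q.re * q.imI)) * h
    · linear_combination 2 * Real.sin (Real.pi / n) * Real.cos (Real.pi / n) *
        (q.re ^ 2 - q.imI ^ 2 - q.imJ ^ 2 + q.imK ^ 2) * h

lemma quatFrame_jQ_mul (q : Quaternion ℝ) : quatFrame (jQ * q) = kappaV (quatFrame q) := by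
  refine Prod.ext ?_ ?_ <;> ext i <;> fin_cases i <;>
    simp [quatFrame, kappaV, imVec] <;> ring

lemma pureQuat_imVec_conj (q p : Quaternion ℝ) (hp : p.re = 0) :
    pureQuat (imVec (star q * p * q)) = star q * p * q := by
  ext <;> simp [imVec, hp]
  ring

lemma eq_or_eq_neg_of_quatFrame_eq {q r : Quaternion ℝ} (hq : ‖q‖ = 1) (hr : ‖r‖ = 1)
    (h : quatFrame q = quatFrame r) : r = q ∨ r = -q := by
  have hi : star q * iQ * q = star r * iQ * r := by
    rw [← pureQuat_imVec_conj q iQ rfl, ← pureQuat_imVec_conj r iQ rfl,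
      neg_injective (congrArg Prod.fst h)]
  have hj : star q * jQ * q = star r * jQ * r := by
    rw [← pureQuat_imVec_conj q jQ rfl, ← pureQuat_imVec_conj r jQ rfl]
    exact congrArg pureQuat (congrArg Prod.snd h)
  have comm {p : Quaternion ℝ} (hp : star q * p * q = star r * p * r) :
      r * star q * p = p * (r * star q) := by
    calc r * star q * p = r * (star q * p * q) * star q := by
          simp only [mul_assoc, self_mul_star_of_norm_eq_one hq, mul_one]
      _ = r * star r * p * r * star q := by rw [hp]; simp only [mul_assoc]
      _ = p * (r * star q) := by
          rw [self_mul_star_of_norm_eq_one hr, one_mul, mul_assoc]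
  have hs : ‖r * star q‖ = 1 := by rw [norm_mul, norm_star, hq, hr, one_mul]
  have hrs : r * star q * q = r := by
    rw [mul_assoc, star_mul_self_of_norm_eq_one hq, mul_one]
  have ci := comm hi
  have cj := comm hj
  generalize r * star q = s at ci cj hs hrs
  have e1 := congrArg QuaternionAlgebra.imJ ci
  have e2 := congrArg QuaternionAlgebra.imK ci
  have e3 := congrArg QuaternionAlgebra.imK cj
  simp at e1 e2 e3
  have hI : s.imI = 0 := by linarith
  have hJ : s.imJ = 0 := by linarith
  have hK : s.imK = 0 := by linarith
  have hsq := sum_sq_eq_one hs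
  rw [hI, hJ, hK] at hsq
  have hre : s.re ^ 2 = 1 := by linarith
  rcases sq_eq_one_iff.mp hre with h1 | h1
  · left
    have : s = 1 := by ext <;> simp [h1, hI, hJ, hK]
    rw [← hrs, this, one_mul]
  · right
    have : s = -1 := by ext <;> simp [h1, hI, hJ, hK]
    rw [← hrs, this, neg_one_mul]

/-- For anticommuting square roots `x`, `y` of `-1`, four times the projection of `r` onto the
solutions `q` of `iq = -qx` and `jq = qy`. -/
def frameProj (x y r : Quaternion ℝ) : Quaternion ℝ :=
  r + iQ * r * x - jQ * r * y - iQ * jQ * r * (y * x)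

lemma exists_frameProj_ne_zero (v w : Fin 3 → ℝ) :
    ∃ r, frameProj (pureQuat v) (pureQuat w) r ≠ 0 := by
  by_contra! h
  have h0 := congrArg QuaternionAlgebra.re (h 1)
  have h1 := congrArg QuaternionAlgebra.imI (h iQ)
  have h2 := congrArg QuaternionAlgebra.imJ (h jQ)
  have h3 := congrArg QuaternionAlgebra.imK (h (iQ * jQ))
  simp [frameProj] at h0 h1 h2 h3
  linarith

lemma exists_quatFrame_eq {p : (Fin 3 → ℝ) × (Fin 3 → ℝ)} (hp : p ∈ V2) :
    ∃ q : Quaternion ℝ, ‖q‖ = 1 ∧ quatFrame q = p := by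
  obtain ⟨v, w⟩ := p
  obtain ⟨hv, hw, hvw⟩ := hp
  simp only [Fin.sum_univ_three] at hv hw hvw
  have hxx : pureQuat v * pureQuat v = -1 := by
    ext <;> simp
    · linarith
    all_goals ring
  have hyy : pureQuat w * pureQuat w = -1 := by
    ext <;> simp
    · linarith
    all_goals ring
  have hxy : pureQuat v * pureQuat w = -(pureQuat w * pureQuat v) := by
    ext <;> simp
    · linarith
    all_goals ring
  have hii : iQ * iQ = -1 := by ext <;> simp
  have hjj : jQ * jQ = -1 := by ext <;> simp
  have hij : jQ * iQ = -(iQ * jQ) := by ext <;> simp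
  have hii' (z) : iQ * (iQ * z) = -z := by rw [← mul_assoc, hii, neg_one_mul]
  have hjj' (z) : jQ * (jQ * z) = -z := by rw [← mul_assoc, hjj, neg_one_mul]
  have hij' (z) : jQ * (iQ * z) = -(iQ * (jQ * z)) := by
    rw [← mul_assoc, hij, neg_mul, mul_assoc]
  have hyy' (z) : pureQuat w * (pureQuat w * z) = -z := by rw [← mul_assoc, hyy, neg_one_mul]
  obtain ⟨r, hr⟩ := exists_frameProj_ne_zero v w
  have hi : iQ * frameProj (pureQuat v) (pureQuat w) r =
      -(frameProj (pureQuat v) (pureQuat w) r * pureQuat v) := by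
    simp only [frameProj, mul_add, mul_sub, add_mul, sub_mul, mul_assoc, hii', hxx, mul_neg,
      mul_one]
    abel
  have hj : jQ * frameProj (pureQuat v) (pureQuat w) r =
      frameProj (pureQuat v) (pureQuat w) r * pureQuat w := by
    simp only [frameProj, mul_add, mul_sub, add_mul, sub_mul, mul_assoc, hij', hjj', hxy, hyy,
      hyy', mul_neg, mul_one]
    abel
  generalize frameProj (pureQuat v) (pureQuat w) r = s at hr hi hj
  have hn : ‖(‖s‖⁻¹ : ℝ) • s‖ = 1 := by
    rw [norm_smul, norm_inv, norm_norm, inv_mul_cancel₀ (norm_ne_zero_iff.mpr hr)]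
  have hu := star_mul_self_of_norm_eq_one hn
  have hi' : star ((‖s‖⁻¹ : ℝ) • s) * iQ * ((‖s‖⁻¹ : ℝ) • s) = -pureQuat v := by
    rw [mul_assoc, mul_smul_comm, hi, smul_neg, ← smul_mul_assoc, mul_neg, ← mul_assoc, hu,
      one_mul]
  have hj' : star ((‖s‖⁻¹ : ℝ) • s) * jQ * ((‖s‖⁻¹ : ℝ) • s) = pureQuat w := by
    rw [mul_assoc, mul_smul_comm, hj, ← smul_mul_assoc, ← mul_assoc, hu, one_mul]
  refine ⟨_, hn, ?_⟩
  rw [quatFrame, hi', hj']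
  refine Prod.ext ?_ ?_ <;> ext i <;> fin_cases i <;> simp [imVec]

/-- The double cover `S³ → V₂(ℝ³)`. -/
def frameMap (q : UnitQuat) : {p // p ∈ V2} := ⟨quatFrame q.1, quatFrame_mem_V2 q.2⟩

lemma isQuotientMap_frameMap : Topology.IsQuotientMap frameMap := by
  have hc : Continuous frameMap :=
    (continuous_quatFrame.comp continuous_subtype_val).subtype_mk _
  have : ProperSpace (Quaternion ℝ) := FiniteDimensional.proper ℝ _
  have : CompactSpace UnitQuat := by
    refine isCompact_iff_compactSpace (s := {q : Quaternion ℝ | ‖q‖ = 1}).mp ?_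
    convert isCompact_sphere (0 : Quaternion ℝ) 1
    ext q
    simp
  refine hc.isClosedMap.isQuotientMap hc fun p => ?_
  obtain ⟨q, hq, h⟩ := exists_quatFrame_eq p.2
  exact ⟨⟨q, hq⟩, Subtype.ext h⟩

lemma cyclicShift_iterate_self (n : ℕ) (x : Fin n → ℝ) : (cyclicShift n)^[n] x = x := by
  obtain _ | m := n
  · rfl
  have h (k : ℕ) (x : Fin (m + 1) → ℝ) :
      (cyclicShift (m + 1))^[k] x = fun i => x (i + k • 1) := by
    induction k generalizing x with
    | zero => simp
    | succ k ih =>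
      rw [Function.iterate_succ_apply, ih]
      funext i
      rw [cyclicShift, finRotate_apply, succ_nsmul, add_assoc]
  have h0 : (m + 1) • (1 : Fin (m + 1)) = 0 := by
    simpa using card_nsmul_eq_zero' (x := (1 : Fin (m + 1)))
  rw [h, h0]
  simp

lemma epsQ_pow_self {n : ℕ} (hn : 1 ≤ n) : epsQ n ^ n = -1 := by
  have h (k : ℕ) : (epsQ n ^ k).re = Real.cos (k * (Real.pi / n)) ∧
      (epsQ n ^ k).imI = Real.sin (k * (Real.pi / n)) ∧
      (epsQ n ^ k).imJ = 0 ∧ (epsQ n ^ k).imK = 0 := by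
    induction k with
    | zero => simp
    | succ k ih =>
      rw [pow_succ, Nat.cast_succ, add_one_mul, Real.cos_add, Real.sin_add]
      simp [ih, add_comm]
  have hn' := h n
  rw [mul_div_cancel₀ _ (by positivity)] at hn'
  ext <;> simp [hn']

lemma map_neg_of_cyclicShift_equivariant {n : ℕ} (hn : 1 ≤ n) (F : UnitQuat → Fin n → ℝ)
    (hF : ∀ q : UnitQuat,
      F ⟨epsQ n * q.1, by rw [norm_mul, norm_epsQ, q.2, one_mul]⟩ = cyclicShift n (F q))
    (q : UnitQuat) : F ⟨-q.1, by rw [norm_neg, q.2]⟩ = F q := by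
  have h (k : ℕ) (hk : ‖epsQ n ^ k * q.1‖ = 1) :
      F ⟨epsQ n ^ k * q.1, hk⟩ = (cyclicShift n)^[k] (F q) := by
    induction k with
    | zero => simp
    | succ k ih =>
      have hk' : ‖epsQ n ^ k * q.1‖ = 1 := by rw [norm_mul, norm_pow, norm_epsQ, q.2]; simp
      rw [Function.iterate_succ_apply', ← ih hk', ← hF]
      congr 2
      rw [pow_succ', mul_assoc]
  have hk := h n (by rw [norm_mul, norm_pow, norm_epsQ, q.2]; simp)
  rw [cyclicShift_iterate_self] at hk
  rw [← hk]
  congr 2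
  rw [epsQ_pow_self hn, neg_one_mul]

end QuaternionFrames

/-- There exists a continuous `D₂ₙ`-equivariant map
`G : V₂(ℝ³) → M_D(α)` if and only if there exists a continuous `Q₄ₙ`-equivariant map
`F : S³ → M_D(α)`. -/
theorem dihedral_map_iff_quaternion_map (n a₁ a₂ a₃ a₄ : ℕ) (hn : 1 ≤ n)
    (h1 : 0 < a₁) (h2 : 0 < a₂) (h3 : 0 < a₃) (h4 : 0 < a₄)
    (hsum : a₁ + a₂ + a₃ + a₄ = n) :
    ExistsDihedralEquivariantMap n a₁ a₂ a₃ a₄ ↔ ExistsQuatEquivariantMap n a₁ a₂ a₃ a₄ := by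
  constructor
  · rintro ⟨G, hG, hω, hκ⟩
    refine ⟨G ∘ frameMap, hG.comp isQuotientMap_frameMap.continuous, fun q => ?_, fun q => ?_⟩
    · have e := quatFrame_epsQ_mul n q.2
      have h := hω (frameMap q) (e ▸ quatFrame_mem_V2 (by rw [norm_mul, norm_epsQ, q.2, one_mul]))
      rw [Function.comp_apply, Function.comp_apply, ← h]
      exact congrArg (fun v => (G v).1) (Subtype.ext e)
    · have e := quatFrame_jQ_mul q.1
      have h := hκ (frameMap q) (e ▸ quatFrame_mem_V2 (by rw [norm_mul, norm_jQ, q.2, one_mul]))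
      rw [Function.comp_apply, Function.comp_apply, ← h]
      exact congrArg (fun v => (G v).1) (Subtype.ext e)
  · rintro ⟨F, hF, hε, hj⟩
    have hfac : Function.FactorsThrough F frameMap := by
      intro q r hqr
      rcases eq_or_eq_neg_of_quatFrame_eq q.2 r.2 (congrArg Subtype.val hqr) with h | h
      · rw [Subtype.ext h]
      · refine Subtype.ext ?_
        rw [← map_neg_of_cyclicShift_equivariant hn (fun q => (F q).1) hε q]
        exact congrArg (fun v => (F v).1) (Subtype.ext h.symm)
    let P : C(UnitQuat, {p // p ∈ V2}) := ⟨frameMap, isQuotientMap_frameMap.continuous⟩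
    have hP : Topology.IsQuotientMap P := isQuotientMap_frameMap
    let G := hP.lift ⟨F, hF⟩ hfac
    have hG (q : UnitQuat) : G (frameMap q) = F q :=
      DFunLike.congr_fun (hP.lift_comp ⟨F, hF⟩ hfac) q
    refine ⟨G, G.continuous, fun v h => ?_, fun v h => ?_⟩
    · obtain ⟨q, rfl⟩ := isQuotientMap_frameMap.surjective v
      rw [hG, ← hε, ← hG]
      exact congrArg (fun v => (G v).1) (Subtype.ext (quatFrame_epsQ_mul n q.2).symm)
    · obtain ⟨q, rfl⟩ := isQuotientMap_frameMap.surjective v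
      rw [hG, ← hj, ← hG]
      exact congrArg (fun v => (G v).1) (Subtype.ext (quatFrame_jQ_mul q.1).symm)
end
end

section
/- (A) If γ₁ and γ₂ are two continuous actions of a finite group G on S³ and γ₁ is free, then there exists a continuous map f : S³ → S³ satisfying f(γ₁(g,x)) = γ₂(g, f(x)) for all g ∈ G and x ∈ S³. (B) If in addition γ₂ is free, then for every topological space Z equipped with a continuous G-action, there exists a continuous G-equivariant map S³ → Z with respect to γ₁ if and only if there exists one with respect to γ₂. -/
/-- The unit sphere `S³ ⊂ ℝ⁴`. -/
abbrev S3 : Type := ↥(Metric.sphere (0 : EuclideanSpace ℝ (Fin 4)) 1)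

open Set Filter Topology Metric Module

/-- The unit sphere of an `(n + 1)`-dimensional Euclidean space has Hausdorff dimension at
most `n`. -/
theorem dimH_unitSphere_le {E : Type*} [NormedAddCommGroup E] [InnerProductSpace ℝ E] {n : ℕ}
    [hn : Fact (finrank ℝ E = n + 1)] : dimH (sphere (0 : E) 1) ≤ n := by
  have : FiniteDimensional ℝ E := .of_fact_finrank_eq_succ n
  have : Nontrivial E := nontrivial_of_finrank_pos (R := ℝ) (by rw [hn.out]; omega)
  obtain ⟨v, hv⟩ := exists_norm_eq E zero_le_one
  have hv0 : v ≠ 0 := by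
    rintro rfl
    simp at hv
  set p : (ℝ ∙ v)ᗮ → E := fun w => stereoInvFunAux v w
  have hp : ContDiff ℝ 1 p := contDiff_stereoInvFunAux.comp (ℝ ∙ v)ᗮ.subtypeL.contDiff
  have hsub : sphere (0 : E) 1 ⊆ range p ∪ {v} := by
    intro x hx
    by_cases hxv : x = v
    · exact Or.inr hxv
    · exact Or.inl ⟨stereoToFun v x, congrArg Subtype.val (stereo_left_inv hv (x := ⟨x, hx⟩) hxv)⟩
  calc dimH (sphere (0 : E) 1) ≤ dimH (range p ∪ {v}) := dimH_mono hsub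
    _ = dimH (range p) := by rw [dimH_union, dimH_singleton, max_eq_left zero_le]
    _ ≤ finrank ℝ (ℝ ∙ v)ᗮ := hp.dimH_range_le
    _ = n := by rw [Submodule.finrank_orthogonal_span_singleton (n := n) hv0]

/-- A map that is nonzero, close to `F`, and agrees with `F` where `‖F x‖ = 1`. -/
theorem exists_continuous_ne_zero_eqOn_norm_eq_one {X F : Type*} [TopologicalSpace X]
    [NormedAddCommGroup F] [NormedSpace ℝ F] {f h : X → F} (hf : Continuous f)
    (hh : Continuous h) (h0 : ∀ x, h x ≠ 0) (hfh : ∀ x, ‖h x - f x‖ < 1 / 2) :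
    ∃ e : X → F, Continuous e ∧ (∀ x, e x ≠ 0) ∧ ∀ x, ‖f x‖ = 1 → e x = f x := by
  set φ : X → ℝ := fun x => max 0 (min 1 (4 * ‖f x‖ - 3)) with hφ
  have hφ0 : ∀ x, 0 ≤ φ x := fun x => le_max_left _ _
  have hφ1 : ∀ x, φ x ≤ 1 := fun x => max_le zero_le_one (min_le_left _ _)
  refine ⟨fun x => f x + (1 - φ x) • (h x - f x), by fun_prop, fun x hx => ?_, fun x hx => ?_⟩
  · rcases le_or_gt ‖f x‖ (3 / 4) with hle | hlt
    · have : φ x = 0 := max_eq_left ((min_le_right _ _).trans (by linarith))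
      simp only [this, sub_zero, one_smul, add_sub_cancel] at hx
      exact h0 x hx
    · have h1 : ‖f x‖ = (1 - φ x) * ‖h x - f x‖ := by
        rw [congrArg norm (eq_neg_of_add_eq_zero_left hx), norm_neg, norm_smul, Real.norm_eq_abs,
          abs_of_nonneg (sub_nonneg.2 (hφ1 x))]
      nlinarith [hφ0 x, hφ1 x, hfh x, norm_nonneg (h x - f x)]
  · have : φ x = 1 := by simp [hφ, hx]; norm_num
    simp [this]

/-- Maps into the unit sphere of `F` extend from closed subsets of a space of Hausdorff
dimension smaller than the dimension of `F`. -/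
theorem exists_continuous_extension_to_unitSphere {E F : Type*}
    [NormedAddCommGroup E] [NormedSpace ℝ E] [FiniteDimensional ℝ E]
    [NormedAddCommGroup F] [NormedSpace ℝ F] [FiniteDimensional ℝ F]
    {K : Set E} (hK : IsClosed K) (hdim : dimH K < finrank ℝ F)
    {A : Set K} (hA : IsClosed A) {f : K → sphere (0 : F) 1} (hf : ContinuousOn f A) :
    ∃ f' : K → sphere (0 : F) 1, Continuous f' ∧ EqOn f' f A := by
  obtain ⟨T, hT⟩ := ContinuousMap.exists_extension' (Y := F)
    (hK.isClosedEmbedding_subtypeVal.comp hA.isClosedEmbedding_subtypeVal)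
    ⟨fun a : A => (f a : F), continuous_subtype_val.comp hf.domRestrict⟩
  obtain ⟨h, hh, hhT, -⟩ := T.continuous.exists_contDiff_approx 1
    (continuous_const (y := (1 / 4 : ℝ))) (fun _ => by norm_num)
  obtain ⟨y, hyK, hy⟩ := (hh.contDiffOn.dense_compl_image_of_dimH_lt_finrank convex_univ
    (subset_univ K) hdim).exists_dist_lt 0 (ε := 1 / 4) (by norm_num)
  obtain ⟨e, hec, he0, heT⟩ := exists_continuous_ne_zero_eqOn_norm_eq_one
    (f := fun x : K => T x) (h := fun x : K => h x - y)
    (by fun_prop) ((hh.continuous.comp continuous_subtype_val).sub continuous_const)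
    (fun x hx => hyK ⟨x, x.2, sub_eq_zero.1 hx⟩) (fun x => by
      have h1 := hhT x
      rw [dist_eq_norm] at h1
      rw [dist_zero_left] at hy
      calc ‖h x - y - T x‖ = ‖(h x - T x) - y‖ := by congr 1; abel
        _ ≤ ‖h x - T x‖ + ‖y‖ := norm_sub_le _ _
        _ < 1 / 2 := by linarith)
  refine ⟨fun x => ⟨‖e x‖⁻¹ • e x, by simp [norm_smul, he0 x]⟩, ?_, fun x hx => ?_⟩
  · exact ((hec.norm.inv₀ fun x => norm_ne_zero_iff.2 (he0 x)).smul hec).subtype_mk _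
  · have h1 : T x = f x := congrFun hT ⟨x, hx⟩
    have h2 : ‖(f x : F)‖ = 1 := norm_eq_of_mem_sphere _
    have h3 : e x = f x := (heT x (by rw [h1, h2])).trans h1
    ext1
    simp [h3]

/-- Under a free action of a finite group, every point of a regular Hausdorff space has a closed
neighbourhood disjoint from its nontrivial translates. -/
theorem exists_closed_nhds_disjoint_translates {G X : Type*} [Group G] [Finite G]
    [TopologicalSpace X] [T2Space X] [RegularSpace X] {α : G → X → X}
    (hα : ∀ g, Continuous (α g)) (hfree : ∀ g x, α g x = x → g = 1)
    (x : X) : ∃ C ∈ 𝓝 x, IsClosed C ∧ ∀ g, ∀ c ∈ C, α g c ∈ C → g = 1 := by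
  have key : ∀ g, ∃ U ∈ 𝓝 x, g = 1 ∨ ∀ c ∈ U, α g c ∉ U := by
    intro g
    by_cases hg : g = 1
    · exact ⟨univ, univ_mem, Or.inl hg⟩
    obtain ⟨U, V, hU, hV, hxU, hxV, hd⟩ := t2_separation fun h => hg (hfree g x h)
    refine ⟨V ∩ α g ⁻¹' U, inter_mem (hV.mem_nhds hxV) ((hα g).continuousAt (hU.mem_nhds hxU)),
      Or.inr fun c hc hc' => disjoint_left.1 hd hc.2 hc'.1⟩
  choose U hU hgU using key
  obtain ⟨C, hC, hCc, hCU⟩ := exists_mem_nhds_isClosed_subset (iInter_mem.2 hU)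
  exact ⟨C, hC, hCc, fun g c hc hgc => (hgU g).resolve_right fun h =>
    h c (mem_iInter.1 (hCU hc) g) (mem_iInter.1 (hCU hgc) g)⟩

/-- If maps into `Y` extend from all closed subsets of the compact space `X`, then every free
action of a finite group on `X` admits an equivariant map to every action on `Y`. -/
theorem exists_equivariant_of_extension {G X Y : Type*} [Group G] [Finite G]
    [TopologicalSpace X] [CompactSpace X] [T2Space X] [TopologicalSpace Y] [T2Space Y]
    [Nonempty Y] {α : G → X → X} {β : G → Y → Y}
    (hα : ∀ g, Continuous (α g)) (hβ : ∀ g, Continuous (β g))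
    (hαone : ∀ x, α 1 x = x) (hαmul : ∀ g h x, α g (α h x) = α (g * h) x)
    (hβone : ∀ y, β 1 y = y) (hβmul : ∀ g h y, β g (β h y) = β (g * h) y)
    (hfree : ∀ g x, α g x = x → g = 1)
    (hext : ∀ (A : Set X) (f : X → Y), IsClosed A → ContinuousOn f A →
      ∃ f' : X → Y, Continuous f' ∧ EqOn f' f A) :
    ∃ f : X → Y, Continuous f ∧ ∀ g x, f (α g x) = β g (f x) := by
  suffices ∀ f : X → Y, Continuous f → ∃ f' : X → Y, Continuous f' ∧
      ∀ x ∈ {x | ∀ g, f (α g x) = β g (f x)} ∪ univ, ∀ g, f' (α g x) = β g (f' x) by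
    obtain ⟨f, hf⟩ : ∃ f : X → Y, Continuous f := ⟨fun _ => Classical.arbitrary Y, continuous_const⟩
    obtain ⟨f', hf', he⟩ := this f hf
    exact ⟨f', hf', fun g x => he x (Or.inr trivial) g⟩
  refine isCompact_univ.induction_on (p := fun s : Set X => ∀ f : X → Y, Continuous f →
    ∃ f' : X → Y, Continuous f' ∧
      ∀ x ∈ {x | ∀ g, f (α g x) = β g (f x)} ∪ s, ∀ g, f' (α g x) = β g (f' x)) ?_ ?_ ?_ ?_
  · exact fun f hf => ⟨f, hf, fun x hx => by simpa using hx⟩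
  · intro s t hst ht f hf
    obtain ⟨f', hf', he⟩ := ht f hf
    exact ⟨f', hf', fun x hx => he x (hx.imp_right (@hst x))⟩
  · intro s t hs ht f hf
    obtain ⟨f₁, hf₁, he₁⟩ := hs f hf
    obtain ⟨f₂, hf₂, he₂⟩ := ht f₁ hf₁
    refine ⟨f₂, hf₂, fun x hx => he₂ x ?_⟩
    rcases hx with hx | hx | hx
    · exact Or.inl (he₁ x (Or.inl hx))
    · exact Or.inl (he₁ x (Or.inr hx))
    · exact Or.inr hx
  intro x _
  obtain ⟨C, hCx, hC, hCα⟩ := exists_closed_nhds_disjoint_translates hα hfree x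
  refine ⟨C, by simpa using hCx, fun f hf => ?_⟩
  have hinv : ∀ g y, α g⁻¹ (α g y) = y := fun g y => by rw [hαmul, inv_mul_cancel, hαone]
  have hinv' : ∀ g y, α g (α g⁻¹ y) = y := fun g y => by rw [hαmul, mul_inv_cancel, hαone]
  set A : Set X := {x | ∀ g, f (α g x) = β g (f x)} with hAdef
  have hA : IsClosed A := by
    simp only [hAdef, ofPred_forall]
    exact isClosed_iInter fun g => isClosed_eq (hf.comp (hα g)) ((hβ g).comp hf)
  have hAα : ∀ g y, y ∈ A → α g y ∈ A := by
    intro g y hy k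
    rw [hαmul, hy, hy, hβmul]
  let D : G → Set X := fun g => α g⁻¹ ⁻¹' C
  have hD : ∀ g, IsClosed (D g) := fun g => hC.preimage (hα _)
  have hDuniq : ∀ g k y, y ∈ D g → y ∈ D k → g = k := by
    intro g k y hg hk
    have := hCα (k⁻¹ * g) _ hg (by rw [← hαmul, hinv']; exact hk)
    exact (inv_mul_eq_one.1 this).symm
  classical
  let F : X → Y := fun y => if h : ∃ g, y ∈ D g then β h.choose (f (α h.choose⁻¹ y)) else f y
  have hFD : ∀ g, EqOn F (fun y => β g (f (α g⁻¹ y))) (D g) := by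
    intro g y hy
    have h : ∃ g, y ∈ D g := ⟨g, hy⟩
    have hg : h.choose = g := hDuniq _ _ y h.choose_spec hy
    simp only [F, dif_pos h, hg]
  have hFA : EqOn F f A := by
    intro y hy
    by_cases h : ∃ g, y ∈ D g
    · obtain ⟨g, hg⟩ := h
      rw [hFD g hg]
      dsimp only
      rw [hy, hβmul, mul_inv_cancel, hβone]
    · simp only [F, dif_neg h]
  obtain ⟨f', hf', hfF⟩ := hext (A ∪ ⋃ g, D g) F (hA.union (isClosed_iUnion_of_finite hD)) <|
    (hf.continuousOn.congr hFA).union_of_isClosed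
      ((locallyFinite_of_finite D).continuousOn_iUnion hD fun g =>
        ((hβ g).comp (hf.comp (hα _))).continuousOn.congr (hFD g))
      hA (isClosed_iUnion_of_finite hD)
  refine ⟨f', hf', fun y hy g => ?_⟩
  rcases hy with hy | hy
  · rw [hfF (Or.inl hy), hfF (Or.inl (hAα g y hy)), hFA hy, hFA (hAα g y hy), hy]
  · have h1 : y ∈ D 1 := by simpa [D, hαone] using hy
    have hg : α g y ∈ D g := by simpa [D, hinv] using hy
    rw [hfF (Or.inr (mem_iUnion.2 ⟨_, h1⟩)), hfF (Or.inr (mem_iUnion.2 ⟨_, hg⟩)), hFD 1 h1,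
      hFD g hg]
    simp only [hinv, inv_one, hαone, hβone]

/-- A free action of a finite group on `S³` admits an equivariant map to any other action on
`S³`. -/
theorem exists_equivariant_S3 {G : Type*} [Group G] [Finite G] {α β : G → S3 → S3}
    (hα : ∀ g, Continuous (α g)) (hβ : ∀ g, Continuous (β g))
    (hαone : ∀ x, α 1 x = x) (hαmul : ∀ g h x, α g (α h x) = α (g * h) x)
    (hβone : ∀ y, β 1 y = y) (hβmul : ∀ g h y, β g (β h y) = β (g * h) y)
    (hfree : ∀ g x, α g x = x → g = 1) :
    ∃ f : S3 → S3, Continuous f ∧ ∀ g x, f (α g x) = β g (f x) := by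
  have : Fact (finrank ℝ (EuclideanSpace ℝ (Fin 4)) = 3 + 1) := ⟨by simp⟩
  have : Nonempty S3 := (NormedSpace.sphere_nonempty.2 zero_le_one).to_subtype
  refine exists_equivariant_of_extension hα hβ hαone hαmul hβone hβmul hfree fun A f hA hf => ?_
  refine exists_continuous_extension_to_unitSphere isClosed_sphere
    ((dimH_unitSphere_le (n := 3)).trans_lt ?_) hA hf
  rw [finrank_euclideanSpace_fin]
  exact_mod_cast Nat.lt_succ_self 3

/-- (A) If `γ₁` and `γ₂` are two continuous actions of a finite group `G` on `S³` and `γ₁` is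
free, then there is a continuous map `f : S³ → S³` with `f(γ₁(g,x)) = γ₂(g, f x)`.
(B) If moreover `γ₂` is free, then for every topological space `Z` with a continuous
`G`-action there is a continuous `G`-equivariant map `S³ → Z` w.r.t. `γ₁` iff there is one
w.r.t. `γ₂`. -/
theorem equivariant_map_between_free_actions
    {G : Type*} [Group G] [Finite G]
    (γ₁ γ₂ : G → S3 → S3)
    (hc₁ : ∀ g, Continuous (γ₁ g)) (hc₂ : ∀ g, Continuous (γ₂ g))
    (hone₁ : ∀ x, γ₁ 1 x = x) (hmul₁ : ∀ g h x, γ₁ g (γ₁ h x) = γ₁ (g * h) x)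
    (hone₂ : ∀ x, γ₂ 1 x = x) (hmul₂ : ∀ g h x, γ₂ g (γ₂ h x) = γ₂ (g * h) x)
    (hfree₁ : ∀ g x, γ₁ g x = x → g = 1) :
    (∃ f : S3 → S3, Continuous f ∧ ∀ g x, f (γ₁ g x) = γ₂ g (f x)) ∧
    ((∀ g x, γ₂ g x = x → g = 1) →
      ∀ (Z : Type*) [TopologicalSpace Z] (ζ : G → Z → Z),
        (∀ g, Continuous (ζ g)) → (∀ z, ζ 1 z = z) →
        (∀ g h z, ζ g (ζ h z) = ζ (g * h) z) →
        ((∃ f : S3 → Z, Continuous f ∧ ∀ g x, f (γ₁ g x) = ζ g (f x)) ↔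
         (∃ f : S3 → Z, Continuous f ∧ ∀ g x, f (γ₂ g x) = ζ g (f x)))) := by
  have key := exists_equivariant_S3 hc₁ hc₂ hone₁ hmul₁ hone₂ hmul₂ hfree₁
  refine ⟨key, fun hfree₂ Z _ ζ _ _ _ => ?_⟩
  obtain ⟨p, hp, hpe⟩ := key
  obtain ⟨q, hq, hqe⟩ := exists_equivariant_S3 hc₂ hc₁ hone₂ hmul₂ hone₁ hmul₁ hfree₂
  constructor
  · rintro ⟨f, hf, hfe⟩
    exact ⟨f ∘ q, hf.comp hq, fun g x => by simp only [Function.comp_apply, hqe, hfe]⟩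
  · rintro ⟨f, hf, hfe⟩
    exact ⟨f ∘ p, hf.comp hp, fun g x => by simp only [Function.comp_apply, hpe, hfe]⟩
end
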